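/- arXiv:1806.07586 — 2 statements merged into one kernel-verified Lean document; each statement's English description precedes it below -/
import Mathlib

section
/- Let E′ be a solution to Disjoint A,B-paths on G. Then: (i) there are exactly 2^{|Z|/2} sets X ⊆ Z such that every path of E′ has both its endpoints in X or both its endpoints in Z∖X; (ii) every such X satisfies that |X ∩ A| is even; and (iii) for every such X there is exactly one perfect matching M₁ of H(X) contained in E(T(E′)) and exactly one perfect matching M₂ of H(Z∖X) contained in E(T(E′)), and these satisfy (∏_{e∈M₁} w(e)) · (∏_{e∈M₂} w(e)) = s^{2Λ−ℓ(E′)}. -/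
/-- `f` is a family of `(|A|+|B|)/2` pairwise vertex-disjoint simple paths of `G`,
each with both endpoints in `A` or both endpoints in `B`, such that every vertex of
`A ∪ B` is an endpoint of one of the paths, and `E'` is the union of their edge
sets.  This witnesses that `E'` is a solution to Disjoint `A`,`B`-paths. -/
def IsPathFamily {V : Type} [DecidableEq V] (G : SimpleGraph V) (A B : Finset V)
    (E' : Set (Sym2 V)) {k : ℕ} (f : Fin k → (u : V) × (v : V) × G.Walk u v) : Prop :=
  k = (A.card + B.card) / 2 ∧
  (∀ i, (f i).2.2.IsPath) ∧
  (∀ i, ((f i).1 ∈ A ∧ (f i).2.1 ∈ A) ∨ ((f i).1 ∈ B ∧ (f i).2.1 ∈ B)) ∧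
  (∀ i j, i ≠ j → ∀ x, x ∈ (f i).2.2.support → x ∉ (f j).2.2.support) ∧
  (∀ z, z ∈ A ∪ B → ∃ i, z = (f i).1 ∨ z = (f i).2.1) ∧
  E' = ⋃ i, {e | e ∈ (f i).2.2.edges}

/-- `E'` is a solution to Disjoint `A`,`B`-paths on `G`. -/
def IsSolution {V : Type} [DecidableEq V] (G : SimpleGraph V) (A B : Finset V)
    (E' : Set (Sym2 V)) : Prop :=
  ∃ (k : ℕ) (f : Fin k → (u : V) × (v : V) × G.Walk u v), IsPathFamily G A B E' f

/-- The length of an edge set: the sum of the lengths of its edges. -/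
noncomputable def lengthOf {V : Type} (ℓ : Sym2 V → ℕ) (E' : Set (Sym2 V)) : ℕ :=
  ∑ᶠ e ∈ E', ℓ e

/-- `ℓ_{A,B}`: the minimum length of a solution to Disjoint `A`,`B`-paths. -/
noncomputable def lAB {V : Type} [DecidableEq V] (G : SimpleGraph V) (A B : Finset V)
    (ℓ : Sym2 V → ℕ) : ℕ :=
  sInf {n | ∃ E', IsSolution G A B E' ∧ lengthOf ℓ E' = n}

/-- `S_{A,B}`: the number of minimum-length solutions to Disjoint `A`,`B`-paths. -/
noncomputable def nSol {V : Type} [DecidableEq V] (G : SimpleGraph V) (A B : Finset V)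
    (ℓ : Sym2 V → ℕ) : ℕ :=
  Set.ncard {E' | IsSolution G A B E' ∧ lengthOf ℓ E' = lAB G A B ℓ}


/-- The vertex type of the gadget graph `H`: `Sum.inl (v, i)` is the gadget vertex
`hᵢ(v)` and `Sum.inr z` is the terminal center `h(z)` (used only for `z ∈ Z`). -/
abbrev HVert (V : Type) : Type := (V × Fin 3) ⊕ V

/-- Base relation for the gadget graph `H`: triangle edges inside nonterminal
gadgets, star edges inside terminal gadgets, and external edges between gadgets
(one external edge `h_{idx u (uv)}(u) h_{idx v (uv)}(v)` for every edge `uv` of `G`). -/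
def hRel {V : Type} (G : SimpleGraph V) (idx : V → Sym2 V → Fin 3) (Z : Finset V) :
    HVert V → HVert V → Prop
  | .inl (u, i), .inl (w, j) =>
      (u = w ∧ u ∉ Z ∧ i ≠ j) ∨
      (G.Adj u w ∧ idx u s(u, w) = i ∧ idx w s(u, w) = j)
  | .inr z, .inl (w, _) => z ∈ Z ∧ z = w
  | _, _ => False

/-- The gadget graph `H` (with terminal set `Z`). -/
def gadgetGraph {V : Type} (G : SimpleGraph V) (idx : V → Sym2 V → Fin 3)
    (Z : Finset V) : SimpleGraph (HVert V) :=
  SimpleGraph.fromRel (hRel G idx Z)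

/-- The vertex set of `H(X)`: all gadget vertices, and the centers `h(z)` for `z ∈ X`. -/
def gadgetVerts {V : Type} (X : Finset V) : Set (HVert V) :=
  fun x => match x with
  | .inl _ => True
  | .inr z => z ∈ X

/-- `M` is (the edge set of) a perfect matching of `H(X)`. -/
def IsPMgadget {V : Type} (G : SimpleGraph V) (idx : V → Sym2 V → Fin 3)
    (Z X : Finset V) (M : Finset (Sym2 (HVert V))) : Prop :=
  (∀ e ∈ M, e ∈ (gadgetGraph G idx Z).edgeSet ∧ ∀ x ∈ e, x ∈ gadgetVerts X) ∧
  (∀ x ∈ gadgetVerts X, ∃! e, e ∈ M ∧ x ∈ e)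

/-- The endpoint, in the gadget of `u`, of the external edge of `H` representing the
edge `uv'` of `G`; this is `f(uv') = h_{idx u (uv')}(u)`. -/
def fEnd {V : Type} (idx : V → Sym2 V → Fin 3) (u v' : V) : HVert V :=
  Sum.inl (u, idx u s(u, v'))

/-- The external edge of `H` representing an edge of `G`. -/
def extEdge {V : Type} (idx : V → Sym2 V → Fin 3) : Sym2 V → Sym2 (HVert V) :=
  Sym2.lift ⟨fun u v => s(fEnd idx u v, fEnd idx v u), by
    intro u v
    exact Sym2.eq_swap⟩

open Classical in
/-- The weight of an edge of `H`: `s ^ ℓ(e)` for the external edge representing the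
edge `e` of `G`, and `1` for internal edges (as a polynomial in `ℤ[s]`). -/
noncomputable def wt {V : Type} (G : SimpleGraph V) (ℓ : Sym2 V → ℕ)
    (idx : V → Sym2 V → Fin 3) (ε : Sym2 (HVert V)) : Polynomial ℤ :=
  if h : ∃ e, e ∈ G.edgeSet ∧ ε = extEdge idx e then Polynomial.X ^ ℓ h.choose else 1

open Classical in
/-- `pm(H(X))`: the sum of the weights of all perfect matchings of `H(X)`. -/
noncomputable def pmPoly {V : Type} [Fintype V] [DecidableEq V] (G : SimpleGraph V)
    (ℓ : Sym2 V → ℕ) (idx : V → Sym2 V → Fin 3) (Z X : Finset V) : Polynomial ℤ :=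
  ∑ M ∈ Finset.univ.filter (fun M : Finset (Sym2 (HVert V)) => IsPMgadget G idx Z X M),
    ∏ e ∈ M, wt G ℓ idx e

open Classical in
/-- The polynomial `p(G,s) = Σ_{X ⊆ Z} (−1)^{|X∩A|} pm(H(X)) pm(H(Z∖X))`. -/
noncomputable def pPoly {V : Type} [Fintype V] [DecidableEq V] (G : SimpleGraph V)
    (A B : Finset V) (ℓ : Sym2 V → ℕ) (idx : V → Sym2 V → Fin 3) : Polynomial ℤ :=
  ∑ X ∈ (A ∪ B).powerset,
    (-1 : Polynomial ℤ) ^ (X ∩ A).card *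
      (pmPoly G ℓ idx (A ∪ B) X * pmPoly G ℓ idx (A ∪ B) ((A ∪ B) \ X))

/-- `Λ`: the total length of all edges of `G`. -/
noncomputable def totalLen {V : Type} (G : SimpleGraph V) (ℓ : Sym2 V → ℕ) : ℕ :=
  ∑ᶠ e ∈ G.edgeSet, ℓ e

/-- The edges of `T(E')` coming from the paths of the solution `E'`: the external
edges of the edges of `E'`, the internal star edges `h(z)f(zu)` at the terminal
endpoint `z` of a path of `E'` continuing with the edge `zu`, and the internal gadget
edges `g(uv)f(vw)` at an inner vertex `v` of a path of `E'` with neighbours `u`, `w`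
on the path. -/
def TsetBase {V : Type} (idx : V → Sym2 V → Fin 3) (E' : Set (Sym2 V)) (Z : Finset V) :
    Set (Sym2 (HVert V)) :=
  {ε | ∃ e ∈ E', ε = extEdge idx e} ∪
  {ε | ∃ z ∈ Z, ∃ u : V, s(z, u) ∈ E' ∧ ε = s(Sum.inr z, fEnd idx z u)} ∪
  {ε | ∃ v u w : V, u ≠ w ∧ s(u, v) ∈ E' ∧ s(v, w) ∈ E' ∧
        ε = s(fEnd idx v u, fEnd idx v w)}

/-- The edge set of the subgraph `T(E')` of `H`: the edges above, together with the
unique external edge at every vertex of `H` not covered by them. -/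
def Tset {V : Type} (G : SimpleGraph V) (idx : V → Sym2 V → Fin 3)
    (E' : Set (Sym2 V)) (Z : Finset V) : Set (Sym2 (HVert V)) :=
  TsetBase idx E' Z ∪
  {ε | ∃ v w : V, G.Adj v w ∧ (∀ ε' ∈ TsetBase idx E' Z, fEnd idx v w ∉ ε') ∧
        ε = extEdge idx s(v, w)}

/-- `X` splits the paths of the solution `E'` cleanly: every path of `E'` has both
endpoints in `X` or both endpoints in `Z ∖ X` (any two terminals joined by a path of
`E'` are on the same side of the split). -/
def GoodX {V : Type} [DecidableEq V] (A B : Finset V) (E' : Set (Sym2 V))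
    (X : Finset V) : Prop :=
  ∀ z ∈ A ∪ B, ∀ z' ∈ A ∪ B,
    (SimpleGraph.fromEdgeSet E').Reachable z z' → (z ∈ X ↔ z' ∈ X)

section GadgetMatching

variable {V : Type} {G : SimpleGraph V} {idx : V → Sym2 V → Fin 3}

/-- In a cubic graph whose index maps are injective, every gadget vertex is the endpoint of an
external edge. -/
theorem exists_adj_idx_eq (hcubic : ∀ v : V, (G.neighborSet v).ncard = 3)
    (hidx : ∀ v : V, Set.InjOn (idx v) (G.incidenceSet v)) (v : V) (i : Fin 3) :
    ∃ w, G.Adj v w ∧ fEnd idx v w = Sum.inl (v, i) := by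
  have hinj : Set.InjOn (fun w => idx v s(v, w)) (G.neighborSet v) := by
    intro w hw w' hw' h
    have := hidx v ⟨hw, Sym2.mem_mk_left _ _⟩ ⟨hw', Sym2.mem_mk_left _ _⟩ h
    exact Sym2.congr_right.1 this
  have huniv : (fun w => idx v s(v, w)) '' G.neighborSet v = Set.univ := by
    apply Set.eq_of_subset_of_ncard_le (Set.subset_univ _)
    rw [hinj.ncard_image, hcubic]
    simp [Set.ncard_univ]
  obtain ⟨w, hw, h⟩ := huniv.ge (Set.mem_univ i)
  exact ⟨w, hw, by simpa [fEnd] using h⟩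

theorem fEnd_eq_fEnd_iff (hidx : ∀ v : V, Set.InjOn (idx v) (G.incidenceSet v)) {v w v' w' : V}
    (h : G.Adj v w) (h' : G.Adj v' w') : fEnd idx v w = fEnd idx v' w' ↔ v = v' ∧ w = w' := by
  constructor
  · intro he
    simp only [fEnd, Sum.inl.injEq, Prod.mk.injEq] at he
    obtain ⟨rfl, he⟩ := he
    have := hidx v ⟨h, Sym2.mem_mk_left _ _⟩ ⟨h', Sym2.mem_mk_left _ _⟩ he
    exact ⟨rfl, Sym2.congr_right.1 this⟩
  · rintro ⟨rfl, rfl⟩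
    rfl

theorem extEdge_mk (v w : V) : extEdge idx s(v, w) = s(fEnd idx v w, fEnd idx w v) := rfl

theorem extEdge_injOn (hidx : ∀ v : V, Set.InjOn (idx v) (G.incidenceSet v)) :
    Set.InjOn (extEdge idx) G.edgeSet := by
  intro e he e' he' h
  induction e with | _ v w
  induction e' with | _ v' w'
  have hv : G.Adj v w := he
  have hv' : G.Adj v' w' := he'
  simp only [extEdge_mk, Sym2.eq_iff] at h
  rcases h with ⟨h, -⟩ | ⟨h, -⟩
  · obtain ⟨rfl, rfl⟩ := (fEnd_eq_fEnd_iff hidx hv hv').1 h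
    rfl
  · obtain ⟨rfl, rfl⟩ := (fEnd_eq_fEnd_iff hidx hv hv'.symm).1 h
    exact Sym2.eq_swap

theorem wt_extEdge (hidx : ∀ v : V, Set.InjOn (idx v) (G.incidenceSet v)) (ℓ : Sym2 V → ℕ)
    {e : Sym2 V} (he : e ∈ G.edgeSet) :
    wt G ℓ idx (extEdge idx e) = Polynomial.X ^ ℓ e := by
  have h : ∃ e', e' ∈ G.edgeSet ∧ extEdge idx e = extEdge idx e' := ⟨e, he, rfl⟩
  rw [wt, dif_pos h, ← extEdge_injOn hidx he h.choose_spec.1 h.choose_spec.2]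

theorem inr_notMem_extEdge (z : V) (e : Sym2 V) : Sum.inr z ∉ extEdge idx e := by
  induction e with | _ v w
  simp [extEdge_mk, fEnd]

/-- The combinatorial shape of a union of disjoint paths whose set of endpoints is `Z`: terminals
have degree one, all other vertices have degree zero or two, and every edge is connected to a
terminal. -/
structure IsPathSystem (G : SimpleGraph V) (Z : Finset V) (E' : Set (Sym2 V)) : Prop where
  subset : E' ⊆ G.edgeSet
  terminal : ∀ z ∈ Z, ∃! w, s(z, w) ∈ E'
  inner : ∀ v ∉ Z, ∀ u, s(v, u) ∈ E' → ∃! w, w ≠ u ∧ s(v, w) ∈ E'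
  reachable : ∀ v u, s(v, u) ∈ E' → ∃ z ∈ Z, (SimpleGraph.fromEdgeSet E').Reachable z v

variable {E' : Set (Sym2 V)} {Z X : Finset V}

theorem IsPathSystem.adj (hE : IsPathSystem G Z E') {v w : V} (h : s(v, w) ∈ E') : G.Adj v w :=
  hE.subset h

theorem IsPathSystem.adj_fromEdgeSet (hE : IsPathSystem G Z E') {v w : V} (h : s(v, w) ∈ E') :
    (SimpleGraph.fromEdgeSet E').Adj v w :=
  (SimpleGraph.fromEdgeSet_adj _).2 ⟨h, (hE.adj h).ne⟩

/-- A gadget vertex covered by an edge of `TsetBase` belongs to an edge of `E'`, and the covering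
edge is external, a star edge, or an edge inside the gadget. -/
theorem IsPathSystem.eq_of_fEnd_mem_TsetBase (hE : IsPathSystem G Z E')
    (hidx : ∀ v : V, Set.InjOn (idx v) (G.incidenceSet v)) {v w : V} (h : G.Adj v w)
    {ε : Sym2 (HVert V)} (hε : ε ∈ TsetBase idx E' Z) (hm : fEnd idx v w ∈ ε) :
    s(v, w) ∈ E' ∧ (ε = extEdge idx s(v, w) ∨
      (v ∈ Z ∧ ε = s(Sum.inr v, fEnd idx v w)) ∨
      ∃ u, u ≠ w ∧ s(v, u) ∈ E' ∧ ε = s(fEnd idx v w, fEnd idx v u)) := by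
  rcases hε with (⟨e, he, rfl⟩ | ⟨z, hz, u, hu, rfl⟩) | ⟨a, u, u', hne, hu, hu', rfl⟩
  · induction e with | _ a b
    have hab := hE.adj he
    rw [extEdge_mk, Sym2.mem_iff, fEnd_eq_fEnd_iff hidx h hab,
      fEnd_eq_fEnd_iff hidx h hab.symm] at hm
    rcases hm with ⟨rfl, rfl⟩ | ⟨rfl, rfl⟩
    · exact ⟨he, .inl rfl⟩
    · rw [Sym2.eq_swap]
      exact ⟨he, .inl rfl⟩
  · rw [Sym2.mem_iff, fEnd_eq_fEnd_iff hidx h (hE.adj hu)] at hm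
    rcases hm with hm | ⟨rfl, rfl⟩
    · simp [fEnd] at hm
    · exact ⟨hu, .inr (.inl ⟨hz, rfl⟩)⟩
  · rw [Sym2.eq_swap] at hu
    rw [Sym2.mem_iff, fEnd_eq_fEnd_iff hidx h (hE.adj hu),
      fEnd_eq_fEnd_iff hidx h (hE.adj hu')] at hm
    rcases hm with ⟨rfl, rfl⟩ | ⟨rfl, rfl⟩
    · exact ⟨hu, .inr (.inr ⟨_, hne.symm, hu', rfl⟩)⟩
    · exact ⟨hu', .inr (.inr ⟨_, hne, hu, Sym2.eq_swap⟩)⟩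

theorem IsPathSystem.eq_of_fEnd_mem (hE : IsPathSystem G Z E')
    (hidx : ∀ v : V, Set.InjOn (idx v) (G.incidenceSet v)) {v w : V} (h : G.Adj v w)
    {ε : Sym2 (HVert V)} (hε : ε ∈ Tset G idx E' Z) (hm : fEnd idx v w ∈ ε) :
    ε = extEdge idx s(v, w) ∨
      s(v, w) ∈ E' ∧ ((v ∈ Z ∧ ε = s(Sum.inr v, fEnd idx v w)) ∨
      ∃ u, u ≠ w ∧ s(v, u) ∈ E' ∧ ε = s(fEnd idx v w, fEnd idx v u)) := by
  rcases hε with hε | ⟨a, b, hab, -, rfl⟩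
  · obtain ⟨h1, h2 | h2⟩ := hE.eq_of_fEnd_mem_TsetBase hidx h hε hm
    · exact .inl h2
    · exact .inr ⟨h1, h2⟩
  · rw [extEdge_mk, Sym2.mem_iff, fEnd_eq_fEnd_iff hidx h hab,
      fEnd_eq_fEnd_iff hidx h hab.symm] at hm
    rcases hm with ⟨rfl, rfl⟩ | ⟨rfl, rfl⟩
    · exact .inl rfl
    · rw [Sym2.eq_swap (a := v)]
      exact .inl rfl

theorem eq_of_inr_mem_Tset {z : V} {ε : Sym2 (HVert V)} (hε : ε ∈ Tset G idx E' Z)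
    (hm : Sum.inr z ∈ ε) : ∃ u, s(z, u) ∈ E' ∧ ε = s(Sum.inr z, fEnd idx z u) := by
  rcases hε with ((⟨e, he, rfl⟩ | ⟨z, hz, u, hu, rfl⟩) | ⟨a, u, u', hne, hu, hu', rfl⟩) |
    ⟨a, b, hab, -, rfl⟩
  · exact absurd hm (inr_notMem_extEdge _ _)
  · simp only [fEnd, Sym2.mem_iff, Sum.inr.injEq, reduceCtorEq, or_false] at hm
    subst hm
    exact ⟨u, hu, rfl⟩
  · simp [fEnd] at hm
  · exact absurd hm (inr_notMem_extEdge _ _)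

theorem IsPathSystem.extEdge_mem_Tset (hE : IsPathSystem G Z E')
    (hidx : ∀ v : V, Set.InjOn (idx v) (G.incidenceSet v)) {v w : V} (h : G.Adj v w) :
    extEdge idx s(v, w) ∈ Tset G idx E' Z := by
  by_cases hvw : s(v, w) ∈ E'
  · exact .inl (.inl (.inl ⟨_, hvw, rfl⟩))
  · exact .inr ⟨v, w, h, fun ε hε hm =>
      hvw (hE.eq_of_fEnd_mem_TsetBase hidx h hε hm).1, rfl⟩

/-- The vertices connected by `E'` to a vertex of `X`. -/
def reachSet (E' : Set (Sym2 V)) (X : Finset V) : Set V :=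
  {v | ∃ x ∈ X, (SimpleGraph.fromEdgeSet E').Reachable x v}

theorem IsPathSystem.mem_reachSet_congr (hE : IsPathSystem G Z E') {v w : V} (h : s(v, w) ∈ E') :
    v ∈ reachSet E' X ↔ w ∈ reachSet E' X :=
  exists_congr fun _ => and_congr_right fun _ =>
    ⟨fun hr => hr.trans (hE.adj_fromEdgeSet h).reachable,
      fun hr => hr.trans (hE.adj_fromEdgeSet h).symm.reachable⟩

/-- The set `X` of terminals is a union of classes of terminals connected by `E'`. -/
def Saturated (E' : Set (Sym2 V)) (Z X : Finset V) : Prop :=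
  ∀ z ∈ Z, ∀ z' ∈ Z, (SimpleGraph.fromEdgeSet E').Reachable z z' → (z ∈ X ↔ z' ∈ X)

theorem Saturated.mem_reachSet_iff (hX : Saturated E' Z X) (hXZ : X ⊆ Z) {z v : V} (hz : z ∈ Z)
    (hr : (SimpleGraph.fromEdgeSet E').Reachable z v) : v ∈ reachSet E' X ↔ z ∈ X :=
  ⟨fun ⟨x, hx, hxv⟩ => (hX x (hXZ hx) z hz (hxv.trans hr.symm)).1 hx, fun h => ⟨z, h, hr⟩⟩

/-- The edges of the perfect matching of `H(X)` inside `T(E')` that are not external. -/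
def innerEdges (idx : V → Sym2 V → Fin 3) (E' : Set (Sym2 V)) (X : Finset V) :
    Set (Sym2 (HVert V)) :=
  {ε | ∃ z ∈ X, ∃ u, s(z, u) ∈ E' ∧ ε = s(Sum.inr z, fEnd idx z u)} ∪
  {ε | ∃ v ∈ reachSet E' X, ∃ u w, u ≠ w ∧ s(v, u) ∈ E' ∧ s(v, w) ∈ E' ∧
    ε = s(fEnd idx v u, fEnd idx v w)}

theorem innerEdges_ne_extEdge {ε : Sym2 (HVert V)} (hε : ε ∈ innerEdges idx E' X) {e : Sym2 V}
    (he : e ∈ G.edgeSet) : ε ≠ extEdge idx e := by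
  rintro rfl
  rcases hε with ⟨z, -, u, -, h⟩ | ⟨v, -, u, w, -, -, -, h⟩
  · exact inr_notMem_extEdge (idx := idx) z e (h ▸ Sym2.mem_mk_left _ _)
  · induction e with | _ a b
    have hab : G.Adj a b := he
    simp only [extEdge_mk, Sym2.eq_iff, fEnd, Sum.inl.injEq, Prod.mk.injEq] at h
    apply hab.ne
    grind

theorem wt_innerEdges (ℓ : Sym2 V → ℕ) {ε : Sym2 (HVert V)} (hε : ε ∈ innerEdges idx E' X) :
    wt G ℓ idx ε = 1 :=
  dif_neg fun ⟨_, he, h⟩ => innerEdges_ne_extEdge hε he h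

/-- The edges of `G` whose external edges belong to the perfect matching of `H(X)` inside
`T(E')`. -/
def outerEdges (G : SimpleGraph V) (E' : Set (Sym2 V)) (X : Finset V) : Set (Sym2 V) :=
  {e | e ∈ G.edgeSet ∧ ¬ (e ∈ E' ∧ ∀ v ∈ e, v ∈ reachSet E' X)}

theorem IsPathSystem.mk_mem_outerEdges (hE : IsPathSystem G Z E') {v w : V} (h : G.Adj v w) :
    s(v, w) ∈ outerEdges G E' X ↔ (s(v, w) ∈ E' → v ∉ reachSet E' X) := by
  have h' : s(v, w) ∈ G.edgeSet := h
  simp only [outerEdges, Set.mem_ofPred_eq, h', true_and, not_and, Sym2.ball]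
  refine forall_congr' fun hvw => ?_
  rw [← hE.mem_reachSet_congr hvw]
  tauto

/-- The perfect matching of `H(X)` inside `T(E')`. -/
def splitMatching (G : SimpleGraph V) (idx : V → Sym2 V → Fin 3) (E' : Set (Sym2 V))
    (X : Finset V) : Set (Sym2 (HVert V)) :=
  extEdge idx '' outerEdges G E' X ∪ innerEdges idx E' X

theorem IsPathSystem.splitMatching_subset (hE : IsPathSystem G Z E')
    (hidx : ∀ v : V, Set.InjOn (idx v) (G.incidenceSet v)) (hXZ : X ⊆ Z) :
    splitMatching G idx E' X ⊆ Tset G idx E' Z := by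
  rintro ε (⟨e, he, rfl⟩ | ⟨z, hz, u, hu, rfl⟩ | ⟨v, -, u, w, hne, hu, hw, rfl⟩)
  · induction e with | _ v w
    exact hE.extEdge_mem_Tset hidx he.1
  · exact .inl (.inl (.inr ⟨z, hXZ hz, u, hu, rfl⟩))
  · exact .inl (.inr ⟨v, u, w, hne, Sym2.eq_swap ▸ hu, hw, rfl⟩)

theorem IsPathSystem.notMem_of_ne (hE : IsPathSystem G Z E') {v u w : V} (hne : u ≠ w)
    (hu : s(v, u) ∈ E') (hw : s(v, w) ∈ E') : v ∉ Z :=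
  fun hv => hne ((hE.terminal v hv).unique hu hw)

theorem IsPathSystem.splitMatching_subset_edgeSet (hE : IsPathSystem G Z E')
    (hidx : ∀ v : V, Set.InjOn (idx v) (G.incidenceSet v)) (hXZ : X ⊆ Z)
    {ε : Sym2 (HVert V)} (hε : ε ∈ splitMatching G idx E' X) :
    ε ∈ (gadgetGraph G idx Z).edgeSet ∧ ∀ x ∈ ε, x ∈ gadgetVerts X := by
  rcases hε with ⟨e, he, rfl⟩ | ⟨z, hz, u, hu, rfl⟩ | ⟨v, -, u, w, hne, hu, hw, rfl⟩
  · induction e with | _ v w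
    have h : G.Adj v w := he.1
    refine ⟨?_, ?_⟩
    · simp [extEdge_mk, gadgetGraph, fEnd, hRel, h, h.ne, Sym2.eq_swap (a := w)]
    · rw [extEdge_mk, Sym2.ball]
      exact ⟨trivial, trivial⟩
  · refine ⟨?_, ?_⟩
    · simp [gadgetGraph, fEnd, hRel, hXZ hz]
    · rw [Sym2.ball]
      exact ⟨hz, trivial⟩
  · have hv := hE.notMem_of_ne hne hu hw
    have hne' : fEnd idx v u ≠ fEnd idx v w := fun h =>
      hne ((fEnd_eq_fEnd_iff hidx (hE.adj hu) (hE.adj hw)).1 h).2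
    refine ⟨?_, ?_⟩
    · simp only [fEnd, ne_eq, Sum.inl.injEq, Prod.mk.injEq, true_and] at hne'
      simp [gadgetGraph, fEnd, hRel, hv, hne']
    · rw [Sym2.ball]
      exact ⟨trivial, trivial⟩

theorem IsPathSystem.existsUnique_mem_splitMatching (hE : IsPathSystem G Z E')
    (hcubic : ∀ v : V, (G.neighborSet v).ncard = 3)
    (hidx : ∀ v : V, Set.InjOn (idx v) (G.incidenceSet v)) (hXZ : X ⊆ Z)
    (hX : Saturated E' Z X) {x : HVert V} (hx : x ∈ gadgetVerts X) :
    ∃! ε, ε ∈ splitMatching G idx E' X ∧ x ∈ ε := by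
  have hsub := hE.splitMatching_subset hidx hXZ
  rcases x with ⟨v, i⟩ | z
  · obtain ⟨w, h, hi⟩ := exists_adj_idx_eq hcubic hidx v i
    rw [← hi]
    have hext : extEdge idx s(v, w) ∈ splitMatching G idx E' X →
        s(v, w) ∈ E' → v ∉ reachSet E' X := by
      rintro (⟨e, he, h'⟩ | h')
      · rw [← hE.mk_mem_outerEdges h, ← extEdge_injOn hidx he.1 h h']
        exact he
      · exact absurd rfl (innerEdges_ne_extEdge h' h)
    by_cases hvw : s(v, w) ∈ E' ∧ v ∈ reachSet E' X
    · obtain ⟨hvw, hv⟩ := hvw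
      by_cases hvZ : v ∈ Z
      · have hvX := (hX.mem_reachSet_iff hXZ hvZ (.refl _)).1 hv
        refine ⟨s(Sum.inr v, fEnd idx v w), ⟨.inr (.inl ⟨v, hvX, w, hvw, rfl⟩),
          Sym2.mem_mk_right _ _⟩, ?_⟩
        rintro ε ⟨hε, hm⟩
        rcases hE.eq_of_fEnd_mem hidx h (hsub hε) hm with
          rfl | ⟨-, ⟨-, rfl⟩ | ⟨u, hu, hvu, rfl⟩⟩
        · exact absurd hv (hext hε hvw)
        · rfl
        · exact absurd hvZ (hE.notMem_of_ne hu hvu hvw)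
      · obtain ⟨u, ⟨hu, hvu⟩, huniq⟩ := hE.inner v hvZ w hvw
        refine ⟨s(fEnd idx v w, fEnd idx v u), ⟨.inr (.inr ⟨v, hv, w, u, hu.symm, hvw, hvu, rfl⟩),
          Sym2.mem_mk_left _ _⟩, ?_⟩
        rintro ε ⟨hε, hm⟩
        rcases hE.eq_of_fEnd_mem hidx h (hsub hε) hm with
          rfl | ⟨-, ⟨hvZ', rfl⟩ | ⟨u', hu', hvu', rfl⟩⟩
        · exact absurd hv (hext hε hvw)
        · exact absurd hvZ' hvZ
        · rw [huniq u' ⟨hu', hvu'⟩]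
    · refine ⟨extEdge idx s(v, w), ⟨.inl ⟨_, (hE.mk_mem_outerEdges h).2 (by tauto), rfl⟩,
        Sym2.mem_mk_left _ _⟩, ?_⟩
      rintro ε ⟨hε, hm⟩
      rcases hE.eq_of_fEnd_mem hidx h (hsub hε) hm with h1 | ⟨h1, h2⟩
      · exact h1
      · exfalso
        refine hvw ⟨h1, ?_⟩
        rcases hε with ⟨e, he, rfl⟩ | ⟨z, hz, u, hu, rfl⟩ | ⟨a, ha, u, u', hne, hu, hu', rfl⟩
        · rcases h2 with ⟨-, h2⟩ | ⟨u, hu, hvu, h2⟩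
          · exact absurd (h2 ▸ Sym2.mem_mk_left _ _) (inr_notMem_extEdge (idx := idx) v e)
          · induction e with | _ a b
            have hab : G.Adj a b := he.1
            simp only [extEdge_mk, Sym2.eq_iff, fEnd, Sum.inl.injEq, Prod.mk.injEq] at h2
            exact absurd hab.ne (by grind)
        · simp only [fEnd, Sym2.mem_iff, Sum.inl.injEq, Prod.mk.injEq, reduceCtorEq,
            false_or] at hm
          rw [hm.1]
          exact ⟨z, hz, .refl _⟩
        · simp only [fEnd, Sym2.mem_iff, Sum.inl.injEq, Prod.mk.injEq] at hm
          have : v = a := by tauto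
          rwa [this]
  · have hz : z ∈ X := hx
    obtain ⟨w, hw, huniq⟩ := hE.terminal z (hXZ hz)
    refine ⟨s(Sum.inr z, fEnd idx z w), ⟨.inr (.inl ⟨z, hz, w, hw, rfl⟩),
      Sym2.mem_mk_left _ _⟩, ?_⟩
    rintro ε ⟨hε, hm⟩
    obtain ⟨u, hu, rfl⟩ := eq_of_inr_mem_Tset (hsub hε) hm
    rw [huniq u hu]

/-- In a perfect matching of `H(X)` inside `T(E')`, the external edges along `E'` are those
connected to terminals outside `X`. -/
theorem IsPathSystem.extEdge_mem_iff (hE : IsPathSystem G Z E')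
    (hidx : ∀ v : V, Set.InjOn (idx v) (G.incidenceSet v))
    {M : Finset (Sym2 (HVert V))} (hM : IsPMgadget G idx Z X M)
    (hMT : ↑M ⊆ Tset G idx E' Z) {z v : V} (hz : z ∈ Z)
    (hr : (SimpleGraph.fromEdgeSet E').Reachable z v) {w : V} (hw : s(v, w) ∈ E') :
    extEdge idx s(v, w) ∈ M ↔ z ∉ X := by
  rw [SimpleGraph.reachable_iff_reflTransGen] at hr
  induction hr generalizing w with
  | refl =>
    constructor
    · intro hext hzX
      obtain ⟨ε, ⟨hε, hm⟩, -⟩ := hM.2 (Sum.inr z) hzX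
      obtain ⟨u, hu, rfl⟩ := eq_of_inr_mem_Tset (hMT hε) hm
      obtain rfl := (hE.terminal z hz).unique hu hw
      have := (hM.2 (fEnd idx z u) trivial).unique ⟨hε, Sym2.mem_mk_right _ _⟩
        ⟨hext, Sym2.mem_mk_left _ _⟩
      exact inr_notMem_extEdge (idx := idx) z _ (this ▸ hm)
    · intro hzX
      obtain ⟨ε, ⟨hε, hm⟩, -⟩ := hM.2 (fEnd idx z w) trivial
      rcases hE.eq_of_fEnd_mem hidx (hE.adj hw) (hMT hε) hm with
        rfl | ⟨-, ⟨-, rfl⟩ | ⟨u, hu, hvu, rfl⟩⟩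
      · exact hε
      · exact absurd ((hM.1 _ hε).2 _ (Sym2.mem_mk_left _ _)) hzX
      · exact absurd hz (hE.notMem_of_ne hu hvu hw)
  | @tail a b _ hab ih =>
    have hba : s(b, a) ∈ E' := by
      rw [Sym2.eq_swap]
      exact ((SimpleGraph.fromEdgeSet_adj _).1 hab).1
    have ih := ih (Sym2.eq_swap ▸ hba)
    rw [Sym2.eq_swap] at ih
    rw [← ih]
    have key : ∀ c d, s(b, c) ∈ E' → s(b, d) ∈ E' → c ≠ d →
        extEdge idx s(b, c) ∈ M → extEdge idx s(b, d) ∈ M := by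
      intro c d hc hd hne hext
      have hbZ := hE.notMem_of_ne hne hc hd
      obtain ⟨ε, ⟨hε, hm⟩, -⟩ := hM.2 (fEnd idx b d) trivial
      rcases hE.eq_of_fEnd_mem hidx (hE.adj hd) (hMT hε) hm with
        rfl | ⟨-, ⟨hbZ', rfl⟩ | ⟨u, hu, hvu, rfl⟩⟩
      · exact hε
      · exact absurd hbZ' hbZ
      · obtain rfl := (hE.inner b hbZ d hd).unique ⟨hu, hvu⟩ ⟨hne, hc⟩
        have := (hM.2 (fEnd idx b u) trivial).unique ⟨hε, Sym2.mem_mk_right _ _⟩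
          ⟨hext, Sym2.mem_mk_left _ _⟩
        have hbu := (hE.adj hc).ne
        simp only [extEdge_mk, Sym2.eq_iff, fEnd, Sum.inl.injEq, Prod.mk.injEq] at this
        exact absurd hbu (by grind)
    rcases eq_or_ne w a with rfl | hne
    · rfl
    · exact ⟨key w a hw hba hne, key a w hba hw hne.symm⟩

theorem IsPathSystem.eq_splitMatching (hE : IsPathSystem G Z E')
    (hcubic : ∀ v : V, (G.neighborSet v).ncard = 3)
    (hidx : ∀ v : V, Set.InjOn (idx v) (G.incidenceSet v)) (hXZ : X ⊆ Z)
    (hX : Saturated E' Z X) {M : Finset (Sym2 (HVert V))} (hM : IsPMgadget G idx Z X M)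
    (hMT : ↑M ⊆ Tset G idx E' Z) : (M : Set (Sym2 (HVert V))) = splitMatching G idx E' X := by
  have hsub : (M : Set (Sym2 (HVert V))) ⊆ splitMatching G idx E' X := by
    intro ε hε
    have hext : ∀ v w, G.Adj v w → extEdge idx s(v, w) ∈ M →
        extEdge idx s(v, w) ∈ splitMatching G idx E' X := by
      intro v w h hvw
      refine .inl ⟨_, (hE.mk_mem_outerEdges h).2 fun hvw' hv => ?_, rfl⟩
      obtain ⟨x, hx, hxv⟩ := hv
      exact (hE.extEdge_mem_iff hidx hM hMT (hXZ hx) hxv hvw').1 hvw hx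
    rcases hMT hε with ((⟨e, he, rfl⟩ | ⟨z, hz, u, hu, rfl⟩) | ⟨a, u, u', hne, hu, hu', rfl⟩) |
      ⟨a, b, hab, -, rfl⟩
    · induction e with | _ v w
      exact hext v w (hE.adj he) hε
    · exact .inr (.inl ⟨z, (hM.1 _ hε).2 _ (Sym2.mem_mk_left _ _), u, hu, rfl⟩)
    · rw [Sym2.eq_swap] at hu
      refine .inr (.inr ⟨a, ?_, u, u', hne, hu, hu', rfl⟩)
      obtain ⟨z, hz, hr⟩ := hE.reachable a u hu
      rw [hX.mem_reachSet_iff hXZ hz hr]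
      by_contra hzX
      have hmem := (hE.extEdge_mem_iff hidx hM hMT hz hr hu).2 hzX
      have := (hM.2 (fEnd idx a u) trivial).unique ⟨hε, Sym2.mem_mk_left _ _⟩
        ⟨hmem, Sym2.mem_mk_left _ _⟩
      have hau := (hE.adj hu).ne
      simp only [extEdge_mk, Sym2.eq_iff, fEnd, Sum.inl.injEq, Prod.mk.injEq] at this
      exact absurd hau (by grind)
    · exact hext a b hab hε
  refine hsub.antisymm fun ε hε => ?_
  obtain ⟨x, hx⟩ : ∃ x, x ∈ ε := ⟨_, Sym2.out_fst_mem ε⟩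
  have hxX := (hE.splitMatching_subset_edgeSet hidx hXZ hε).2 x hx
  obtain ⟨ε', ⟨hε', hm⟩, -⟩ := hM.2 x hxX
  rwa [(hE.existsUnique_mem_splitMatching hcubic hidx hXZ hX hxX).unique ⟨hε, hx⟩
    ⟨hsub hε', hm⟩]

theorem IsPathSystem.existsUnique_matching [Finite V] (hE : IsPathSystem G Z E')
    (hcubic : ∀ v : V, (G.neighborSet v).ncard = 3)
    (hidx : ∀ v : V, Set.InjOn (idx v) (G.incidenceSet v)) (hXZ : X ⊆ Z)
    (hX : Saturated E' Z X) :
    ∃! M : Finset (Sym2 (HVert V)), IsPMgadget G idx Z X M ∧ ↑M ⊆ Tset G idx E' Z := by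
  obtain ⟨M, hM⟩ := (Set.toFinite (splitMatching G idx E' X)).exists_finset_coe
  refine ⟨M, ⟨⟨fun ε hε => hE.splitMatching_subset_edgeSet hidx hXZ (hM ▸ hε), fun x hx => ?_⟩,
    hM ▸ hE.splitMatching_subset hidx hXZ⟩, fun M' ⟨h1, h2⟩ => ?_⟩
  · simpa only [← hM, Finset.mem_coe] using hE.existsUnique_mem_splitMatching hcubic hidx hXZ hX hx
  · rw [← Finset.coe_inj, hM]
    exact hE.eq_splitMatching hcubic hidx hXZ hX h1 h2

open Classical in
theorem IsPathSystem.prod_wt [Fintype V] (hE : IsPathSystem G Z E')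
    (hcubic : ∀ v : V, (G.neighborSet v).ncard = 3)
    (hidx : ∀ v : V, Set.InjOn (idx v) (G.incidenceSet v)) (hXZ : X ⊆ Z)
    (hX : Saturated E' Z X) (ℓ : Sym2 V → ℕ) {M : Finset (Sym2 (HVert V))}
    (hM : IsPMgadget G idx Z X M) (hMT : ↑M ⊆ Tset G idx E' Z) :
    ∏ ε ∈ M, wt G ℓ idx ε = Polynomial.X ^ ∑ e ∈ (outerEdges G E' X).toFinset, ℓ e := by
  have h := hE.eq_splitMatching hcubic hidx hXZ hX hM hMT
  rw [← Finset.prod_pow_eq_pow_sum,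
    ← Finset.prod_congr rfl fun e he => wt_extEdge hidx ℓ (Set.mem_toFinset.1 he).1,
    ← Finset.prod_image (f := wt G ℓ idx) (g := extEdge idx) fun e he e' he' =>
      extEdge_injOn hidx (Set.mem_toFinset.1 he).1 (Set.mem_toFinset.1 he').1]
  symm
  refine Finset.prod_subset (fun ε hε => ?_) fun ε hε hε' => ?_
  · rw [← Finset.mem_coe, h]
    left
    simpa using hε
  · rw [← Finset.mem_coe, h] at hε
    rcases hε with hε | hε
    · exact absurd (by simpa using hε) hε'
    · exact wt_innerEdges ℓ hε

theorem Saturated.sdiff [DecidableEq V] (hX : Saturated E' Z X) : Saturated E' Z (Z \ X) := by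
  intro z hz z' hz' hr
  simp [hz, hz', hX z hz z' hz' hr]

open Classical in
theorem IsPathSystem.sum_outerEdges_add [Fintype V] (hE : IsPathSystem G Z E') (hXZ : X ⊆ Z)
    (hX : Saturated E' Z X) {Y : Finset V} (hYZ : Y ⊆ Z) (hY : Saturated E' Z Y)
    (hXY : ∀ z ∈ Z, z ∈ Y ↔ z ∉ X) (ℓ : Sym2 V → ℕ) :
    ∑ e ∈ (outerEdges G E' X).toFinset, ℓ e + ∑ e ∈ (outerEdges G E' Y).toFinset, ℓ e +
      lengthOf ℓ E' = 2 * totalLen G ℓ := by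
  have hsum : ∀ s : Set (Sym2 V), s ⊆ G.edgeSet →
      ∑ e ∈ s.toFinset, ℓ e = ∑ e ∈ G.edgeFinset, if e ∈ s then ℓ e else 0 := by
    intro s hs
    rw [← Finset.sum_filter]
    refine Finset.sum_congr ?_ fun _ _ => rfl
    ext e
    simpa using @hs e
  have h1 : lengthOf ℓ E' = ∑ e ∈ E'.toFinset, ℓ e := by
    rw [lengthOf, finsum_mem_eq_toFinset_sum]
  have h2 : totalLen G ℓ = ∑ e ∈ G.edgeFinset, ℓ e := by
    rw [totalLen, finsum_mem_eq_toFinset_sum]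
    rfl
  rw [h1, h2, hsum _ fun e he => he.1, hsum _ fun e he => he.1, hsum _ hE.subset,
    ← Finset.sum_add_distrib, ← Finset.sum_add_distrib, Finset.mul_sum]
  refine Finset.sum_congr rfl fun e he => ?_
  induction e with | _ v w
  have h : G.Adj v w := by simpa using he
  simp only [hE.mk_mem_outerEdges h]
  by_cases hvw : s(v, w) ∈ E'
  · obtain ⟨z, hz, hr⟩ := hE.reachable v w hvw
    rw [hX.mem_reachSet_iff hXZ hz hr, hY.mem_reachSet_iff hYZ hz hr, hXY z hz]
    by_cases hzX : z ∈ X <;> simp [hvw, hzX] <;> ring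
  · simp [hvw]
    ring

end GadgetMatching

section PathFamily

variable {V : Type} [DecidableEq V] {G : SimpleGraph V} {A B X : Finset V} {E' : Set (Sym2 V)}
  {k : ℕ} {f : Fin k → (u : V) × (v : V) × G.Walk u v}

/-- The endpoints of the walks with indices in `S`. -/
def endpoints (f : Fin k → (u : V) × (v : V) × G.Walk u v) (S : Finset (Fin k)) : Finset V :=
  S.biUnion fun i => {(f i).1, (f i).2.1}

theorem mem_endpoints {S : Finset (Fin k)} {v : V} :
    v ∈ endpoints f S ↔ ∃ i ∈ S, v = (f i).1 ∨ v = (f i).2.1 := by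
  simp [endpoints]

namespace IsPathFamily

theorem index_unique (hf : IsPathFamily G A B E' f) {i j : Fin k} {x : V}
    (hi : x ∈ (f i).2.2.support) (hj : x ∈ (f j).2.2.support) : i = j := by
  by_contra h
  exact hf.2.2.2.1 i j h x hi hj

theorem mem_iff (hf : IsPathFamily G A B E' f) {e : Sym2 V} :
    e ∈ E' ↔ ∃ i, e ∈ (f i).2.2.edges := by
  rw [hf.2.2.2.2.2]
  simp

theorem mem_edges (hf : IsPathFamily G A B E' f) {i : Fin k} {v w : V}
    (hv : v ∈ (f i).2.2.support) (h : s(v, w) ∈ E') : s(v, w) ∈ (f i).2.2.edges := by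
  obtain ⟨j, hj⟩ := hf.mem_iff.1 h
  rwa [hf.index_unique hv (SimpleGraph.Walk.fst_mem_support_of_mem_edges _ hj)]

theorem mk_mem_iff (hf : IsPathFamily G A B E' f) {i : Fin k} {v w : V}
    (hv : v ∈ (f i).2.2.support) : s(v, w) ∈ E' ↔ w ∈ (f i).2.2.toSubgraph.neighborSet v := by
  rw [SimpleGraph.Subgraph.mem_neighborSet, ← SimpleGraph.Subgraph.mem_edgeSet,
    SimpleGraph.Walk.mem_edges_toSubgraph]
  exact ⟨hf.mem_edges hv, fun h => hf.mem_iff.2 ⟨i, h⟩⟩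

theorem endpoint_mem (hf : IsPathFamily G A B E' f) (i : Fin k) :
    (f i).1 ∈ A ∪ B ∧ (f i).2.1 ∈ A ∪ B := by
  have := hf.2.2.1 i
  grind

theorem fst_ne_snd (hf : IsPathFamily G A B E' f) (hdisj : Disjoint A B) (hA : Even A.card)
    (hB : Even B.card) (i : Fin k) : (f i).1 ≠ (f i).2.1 := by
  let g : Fin k × Bool → V := fun p => if p.2 then (f p.1).1 else (f p.1).2.1
  have hcard : (Finset.univ : Finset (Fin k × Bool)).card ≤ (A ∪ B).card := by
    rw [Finset.card_union_of_disjoint hdisj, Finset.card_univ, Fintype.card_prod,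
      Fintype.card_fin, Fintype.card_bool, hf.1, Nat.div_mul_cancel (hA.add hB).two_dvd]
  have hinj := Finset.injOn_of_surjOn_of_card_le (s := Finset.univ) (t := A ∪ B) g
    (fun p _ => by
      have := hf.endpoint_mem p.1
      by_cases h : p.2 <;> simp only [g, h, Finset.mem_coe] <;> simp_all)
    (fun z hz => by
      obtain ⟨i, rfl | rfl⟩ := hf.2.2.2.2.1 z hz
      · exact ⟨(i, true), by simp, rfl⟩
      · exact ⟨(i, false), by simp, rfl⟩) hcard
  intro h
  have := hinj (x₁ := (i, true)) (x₂ := (i, false)) (by simp) (by simp)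
    (by simpa [g] using h)
  simp at this

theorem reachable_fst (hf : IsPathFamily G A B E' f) {i : Fin k} {v : V}
    (hv : v ∈ (f i).2.2.support) : (SimpleGraph.fromEdgeSet E').Reachable (f i).1 v := by
  refine ⟨((f i).2.2.takeUntil v hv).transfer _ fun e he => ?_⟩
  have he' := SimpleGraph.Walk.edges_takeUntil_subset_edges _ hv he
  rw [SimpleGraph.edgeSet_fromEdgeSet]
  exact ⟨hf.mem_iff.2 ⟨i, he'⟩,
    G.not_isDiag_of_mem_edgeSet (SimpleGraph.Walk.edges_subset_edgeSet _ he')⟩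

theorem mem_support_of_reachable (hf : IsPathFamily G A B E' f) {i : Fin k} {v w : V}
    (hv : v ∈ (f i).2.2.support) (h : (SimpleGraph.fromEdgeSet E').Reachable v w) :
    w ∈ (f i).2.2.support := by
  rw [SimpleGraph.reachable_iff_reflTransGen] at h
  induction h with
  | refl => exact hv
  | tail _ hab ih =>
    exact SimpleGraph.Walk.snd_mem_support_of_mem_edges _
      (hf.mem_edges ih ((SimpleGraph.fromEdgeSet_adj _).1 hab).1)

theorem isPathSystem (hf : IsPathFamily G A B E' f) (hne : ∀ i, (f i).1 ≠ (f i).2.1) :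
    IsPathSystem G (A ∪ B) E' where
  subset e he := by
    obtain ⟨i, hi⟩ := hf.mem_iff.1 he
    exact SimpleGraph.Walk.edges_subset_edgeSet _ hi
  terminal z hz := by
    obtain ⟨i, rfl | rfl⟩ := hf.2.2.2.2.1 z hz
    · simp only [hf.mk_mem_iff (SimpleGraph.Walk.start_mem_support _),
        (hf.2.1 i).neighborSet_toSubgraph_startpoint fun h => hne i h.eq]
      exact ⟨_, rfl, fun _ h => h⟩
    · simp only [hf.mk_mem_iff (SimpleGraph.Walk.end_mem_support _),
        (hf.2.1 i).neighborSet_toSubgraph_endpoint fun h => hne i h.eq]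
      exact ⟨_, rfl, fun _ h => h⟩
  inner v hv u hu := by
    obtain ⟨i, hi⟩ := hf.mem_iff.1 hu
    have hvi := SimpleGraph.Walk.fst_mem_support_of_mem_edges _ hi
    rw [hf.mk_mem_iff hvi] at hu
    simp only [hf.mk_mem_iff hvi]
    obtain ⟨n, rfl, hn⟩ := SimpleGraph.Walk.mem_support_iff_exists_getVert.1 hvi
    have h0 : n ≠ 0 := by
      rintro rfl
      exact hv (by simpa using hf.endpoint_mem i |>.1)
    have hlt : n < (f i).2.2.length := by
      refine lt_of_le_of_ne hn ?_
      rintro rfl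
      exact hv (by simpa using hf.endpoint_mem i |>.2)
    obtain ⟨x, y, hxy, h⟩ := Set.ncard_eq_two.1
      ((hf.2.1 i).ncard_neighborSet_toSubgraph_internal_eq_two h0 hlt)
    rw [h] at hu ⊢
    rcases hu with rfl | rfl
    · exact ⟨y, by simp [hxy.symm], by simp +contextual⟩
    · exact ⟨x, by simp [hxy], by simp +contextual⟩
  reachable v u h := by
    obtain ⟨i, hi⟩ := hf.mem_iff.1 h
    exact ⟨_, (hf.endpoint_mem i).1,
      hf.reachable_fst (SimpleGraph.Walk.fst_mem_support_of_mem_edges _ hi)⟩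

theorem goodX_iff (hf : IsPathFamily G A B E' f) :
    GoodX A B E' X ↔ ∀ i, ((f i).1 ∈ X ↔ (f i).2.1 ∈ X) := by
  constructor
  · intro h i
    exact h _ (hf.endpoint_mem i).1 _ (hf.endpoint_mem i).2
      (hf.reachable_fst (SimpleGraph.Walk.end_mem_support _))
  · intro h z hz z' hz' hr
    obtain ⟨i, hi⟩ := hf.2.2.2.2.1 z hz
    obtain ⟨j, hj⟩ := hf.2.2.2.2.1 z' hz'
    have hzi : z ∈ (f i).2.2.support := by
      rcases hi with rfl | rfl <;> simp
    have hzj : z' ∈ (f j).2.2.support := by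
      rcases hj with rfl | rfl <;> simp
    obtain rfl := hf.index_unique (hf.mem_support_of_reachable hzi hr) hzj
    have := h i
    grind

theorem fst_mem_endpoints (hf : IsPathFamily G A B E' f) {S : Finset (Fin k)} {i : Fin k} :
    (f i).1 ∈ endpoints f S ↔ i ∈ S := by
  rw [mem_endpoints]
  constructor
  · rintro ⟨j, hj, h⟩
    rwa [hf.index_unique (SimpleGraph.Walk.start_mem_support (f i).2.2) (j := j)
      (by rcases h with h | h <;> simp [h])]
  · exact fun h => ⟨i, h, .inl rfl⟩

theorem snd_mem_endpoints (hf : IsPathFamily G A B E' f) {S : Finset (Fin k)} {i : Fin k} :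
    (f i).2.1 ∈ endpoints f S ↔ i ∈ S := by
  rw [mem_endpoints]
  constructor
  · rintro ⟨j, hj, h⟩
    rwa [hf.index_unique (SimpleGraph.Walk.end_mem_support (f i).2.2) (j := j)
      (by rcases h with h | h <;> simp [h])]
  · exact fun h => ⟨i, h, .inr rfl⟩

theorem endpoints_injective (hf : IsPathFamily G A B E' f) :
    Function.Injective (endpoints f) := by
  intro S T h
  ext i
  rw [← hf.fst_mem_endpoints, h, hf.fst_mem_endpoints]

theorem endpoints_filter (hf : IsPathFamily G A B E' f) (hX : X ⊆ A ∪ B)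
    (h : ∀ i, ((f i).1 ∈ X ↔ (f i).2.1 ∈ X)) :
    endpoints f {i | (f i).1 ∈ X} = X := by
  ext v
  simp only [mem_endpoints, Finset.mem_filter, Finset.mem_univ, true_and]
  constructor
  · rintro ⟨i, hi, rfl | rfl⟩
    · exact hi
    · exact (h i).1 hi
  · intro hv
    obtain ⟨i, hi⟩ := hf.2.2.2.2.1 v (hX hv)
    refine ⟨i, ?_, hi⟩
    rcases hi with rfl | rfl
    · exact hv
    · exact (h i).2 hv

theorem card_endpoints (hf : IsPathFamily G A B E' f) (hne : ∀ i, (f i).1 ≠ (f i).2.1)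
    (S : Finset (Fin k)) : (endpoints f S).card = S.card * 2 := by
  rw [endpoints, Finset.card_biUnion, Finset.sum_const_nat fun i _ => Finset.card_pair (hne i)]
  intro i _ j _ hij
  refine Finset.disjoint_left.2 fun x hi hj => ?_
  refine hij (hf.index_unique (x := x) ?_ ?_)
  · simp only [Finset.mem_insert, Finset.mem_singleton] at hi
    rcases hi with rfl | rfl <;> simp
  · simp only [Finset.mem_insert, Finset.mem_singleton] at hj
    rcases hj with rfl | rfl <;> simp

theorem ncard_goodX (hf : IsPathFamily G A B E' f) (hdisj : Disjoint A B) :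
    {X : Finset V | X ⊆ A ∪ B ∧ GoodX A B E' X}.ncard = 2 ^ ((A ∪ B).card / 2) := by
  have h : {X : Finset V | X ⊆ A ∪ B ∧ GoodX A B E' X} = Set.range (endpoints f) := by
    ext X
    constructor
    · rintro ⟨hX, hg⟩
      exact ⟨_, hf.endpoints_filter hX (hf.goodX_iff.1 hg)⟩
    · rintro ⟨S, rfl⟩
      refine ⟨fun v hv => ?_, hf.goodX_iff.2 fun i => ?_⟩
      · obtain ⟨i, -, rfl | rfl⟩ := mem_endpoints.1 hv
        exacts [(hf.endpoint_mem i).1, (hf.endpoint_mem i).2]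
      · rw [hf.fst_mem_endpoints, hf.snd_mem_endpoints]
  rw [h, ← Set.image_univ, Set.ncard_image_of_injective _ hf.endpoints_injective, Set.ncard_univ,
    Nat.card_eq_fintype_card, Fintype.card_finset, Fintype.card_fin, hf.1,
    Finset.card_union_of_disjoint hdisj]

theorem even_card_inter (hf : IsPathFamily G A B E' f) (hdisj : Disjoint A B)
    (hne : ∀ i, (f i).1 ≠ (f i).2.1) (hg : GoodX A B E' X) : Even (X ∩ A).card := by
  have h : ∀ i, ((f i).1 ∈ X ∩ A ↔ (f i).2.1 ∈ X ∩ A) := by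
    intro i
    have h1 := hf.goodX_iff.1 hg i
    have h2 := hf.2.2.1 i
    rw [Finset.disjoint_left] at hdisj
    grind
  rw [← hf.endpoints_filter (Finset.inter_subset_right.trans Finset.subset_union_left) h,
    hf.card_endpoints hne]
  exact even_two.mul_left _

end IsPathFamily

end PathFamily

/-!
STATEMENT 4.  Let `E′` be a solution to Disjoint `A`,`B`-paths on the cubic graph `G`.
Then: (i) there are exactly `2^{|Z|/2}` sets `X ⊆ Z` such that every path of `E′` has
both endpoints in `X` or both endpoints in `Z∖X`; (ii) every such `X` has `|X ∩ A|`
even; (iii) for every such `X` there is exactly one perfect matching `M₁` of `H(X)`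
contained in `T(E′)` and exactly one perfect matching `M₂` of `H(Z∖X)` contained in
`T(E′)`, and these satisfy `(∏_{e∈M₁} w e) · (∏_{e∈M₂} w e) = s^{2Λ−ℓ(E′)}`.
-/
theorem stmt4 {V : Type} [Fintype V] [DecidableEq V]
    (G : SimpleGraph V) (A B : Finset V) (ℓ : Sym2 V → ℕ)
    (idx : V → Sym2 V → Fin 3)
    (hdisj : Disjoint A B) (hA : Even A.card) (hB : Even B.card)
    (hcubic : ∀ v : V, (G.neighborSet v).ncard = 3)
    (hidx : ∀ v : V, Set.InjOn (idx v) (G.incidenceSet v))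
    (hℓ : ∀ e ∈ G.edgeSet, 1 ≤ ℓ e)
    (E' : Set (Sym2 V)) (hsol : IsSolution G A B E') :
    -- (i)
    Set.ncard {X : Finset V | X ⊆ A ∪ B ∧ GoodX A B E' X} =
      2 ^ ((A ∪ B).card / 2) ∧
    -- (ii)
    (∀ X : Finset V, X ⊆ A ∪ B → GoodX A B E' X → Even (X ∩ A).card) ∧
    -- (iii)
    (∀ X : Finset V, X ⊆ A ∪ B → GoodX A B E' X →
      (∃! M₁ : Finset (Sym2 (HVert V)),
          IsPMgadget G idx (A ∪ B) X M₁ ∧ ↑M₁ ⊆ Tset G idx E' (A ∪ B)) ∧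
      (∃! M₂ : Finset (Sym2 (HVert V)),
          IsPMgadget G idx (A ∪ B) ((A ∪ B) \ X) M₂ ∧ ↑M₂ ⊆ Tset G idx E' (A ∪ B)) ∧
      (∀ M₁ M₂ : Finset (Sym2 (HVert V)),
        IsPMgadget G idx (A ∪ B) X M₁ → ↑M₁ ⊆ Tset G idx E' (A ∪ B) →
        IsPMgadget G idx (A ∪ B) ((A ∪ B) \ X) M₂ → ↑M₂ ⊆ Tset G idx E' (A ∪ B) →
        (∏ e ∈ M₁, wt G ℓ idx e) * ∏ e ∈ M₂, wt G ℓ idx e =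
          Polynomial.X ^ (2 * totalLen G ℓ - lengthOf ℓ E'))) := by
  classical
  obtain ⟨k, f, hf⟩ := hsol
  have hne := hf.fst_ne_snd hdisj hA hB
  have hE := hf.isPathSystem hne
  refine ⟨hf.ncard_goodX hdisj, fun X _ hg => hf.even_card_inter hdisj hne hg,
    fun X hXZ hg => ?_⟩
  have hX : Saturated E' (A ∪ B) X := hg
  have hX' := hX.sdiff
  refine ⟨hE.existsUnique_matching hcubic hidx hXZ hX,
    hE.existsUnique_matching hcubic hidx Finset.sdiff_subset hX', fun M₁ M₂ h₁ hT₁ h₂ hT₂ => ?_⟩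
  rw [hE.prod_wt hcubic hidx hXZ hX ℓ h₁ hT₁,
    hE.prod_wt hcubic hidx Finset.sdiff_subset hX' ℓ h₂ hT₂, ← pow_add,
    ← hE.sum_outerEdges_add hXZ hX Finset.sdiff_subset hX' (by simp +contextual) ℓ,
    Nat.add_sub_cancel]
end

section
/- A solution to Disjoint A,B-paths on the instance I exists, and the minimum length satisfies ℓ_{A,B} = 12|V| + 3|E| − α(G). -/
/-- Vertex type of the instance `I`: `Sum.inl (v, i)` is the gadget-cycle vertex
`v′_{i+1}` (for `v ∈ V`, `i : Fin 8`), and `Sum.inr (e, k)` is the edge-gadget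
vertex `w′_{k+1}(e)` (used only for edges `e` of `G`). -/
abbrev IVert (V : Type) : Type := (V × Fin 8) ⊕ (Sym2 V × Fin 2)

/-- Base relation of the instance `I`: for each vertex `v` of `G` an 8-cycle
`v′₁ … v′₈`, and for each edge `e = uv` of `G` (with `fs e = u`, `sn e = v`) the four
edges `w′₁(e)u′_{σ_u(e)}`, `w′₂(e)u′_{σ_u(e)+1}`, `w′₁(e)v′_{σ_v(e)+1}`,
`w′₂(e)v′_{σ_v(e)}` (in the `Fin 8`-indexing, `v′_m` is `Sum.inl (v, m-1)`). -/
def iRel {V : Type} (G : SimpleGraph V) (σ : V → Sym2 V → ℕ) (fs sn : Sym2 V → V) :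
    IVert V → IVert V → Prop
  | .inl (v, i), .inl (w, j) =>
      v = w ∧ (i.val + 1 = j.val ∨ (i.val = 7 ∧ j.val = 0))
  | .inr (e, k), .inl (w, i) => e ∈ G.edgeSet ∧
      ((k = 0 ∧ w = fs e ∧ i.val + 1 = σ w e) ∨
       (k = 1 ∧ w = fs e ∧ i.val = σ w e) ∨
       (k = 0 ∧ w = sn e ∧ i.val = σ w e) ∨
       (k = 1 ∧ w = sn e ∧ i.val + 1 = σ w e))
  | _, _ => False

/-- The graph of the instance `I`. -/
def instGraph {V : Type} (G : SimpleGraph V) (σ : V → Sym2 V → ℕ)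
    (fs sn : Sym2 V → V) : SimpleGraph (IVert V) :=
  SimpleGraph.fromRel (iRel G σ fs sn)

open Classical in
/-- Edge lengths of the instance `I`: the cycle edge `v′₈v′₁` has length `12`, the
cycle edges `v′ᵢv′ᵢ₊₁` with `i` odd (`Fin`-index even) have length `2`, and all other
edges have length `1`. -/
noncomputable def instLen {V : Type} : Sym2 (IVert V) → ℕ := fun ε =>
  if ∃ v : V, ε = s((Sum.inl (v, (7 : Fin 8)) : IVert V), Sum.inl (v, (0 : Fin 8)))
  then 12
  else if ∃ (v : V) (i j : Fin 8), i.val % 2 = 0 ∧ i.val + 1 = j.val ∧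
      ε = s((Sum.inl (v, i) : IVert V), Sum.inl (v, j))
  then 2
  else 1

/-- The terminal set `A` of the instance `I`: the vertices `v′₁` and `v′₈`, `v ∈ V`. -/
def instA (V : Type) [Fintype V] [DecidableEq V] : Finset (IVert V) :=
  Finset.univ.image (fun v : V => (Sum.inl (v, (0 : Fin 8)) : IVert V)) ∪
    Finset.univ.image (fun v : V => (Sum.inl (v, (7 : Fin 8)) : IVert V))

/-- The terminal set `B` of the instance `I`: the vertices `w′₁(e)` and `w′₂(e)`,
`e ∈ E`. -/
def instB {V : Type} [Fintype V] [DecidableEq V] (G : SimpleGraph V)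
    [DecidableRel G.Adj] : Finset (IVert V) :=
  G.edgeFinset.image (fun e => (Sum.inr (e, (0 : Fin 2)) : IVert V)) ∪
    G.edgeFinset.image (fun e => (Sum.inr (e, (1 : Fin 2)) : IVert V))

/-- The independence number `α(G)`. -/
noncomputable def indepNum {V : Type} (G : SimpleGraph V) : ℕ :=
  sSup {n | ∃ S : Finset V, (∀ u ∈ S, ∀ w ∈ S, ¬ G.Adj u w) ∧ S.card = n}

theorem exists_two_edges_of_mem_support {V : Type} {G : SimpleGraph V} {u v x : V}
    (p : G.Walk u v) (hp : p.IsPath) (hx : x ∈ p.support) (hu : x ≠ u) (hv : x ≠ v) :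
    ∃ a b, a ≠ b ∧ s(x, a) ∈ p.edges ∧ s(x, b) ∈ p.edges := by
  induction p with
  | nil => simp_all
  | @cons u c v h p ih =>
    rw [SimpleGraph.Walk.cons_isPath_iff] at hp
    have hxp : x ∈ p.support := by simpa [hu] using hx
    by_cases hxc : x = c
    · subst hxc
      cases p with
      | nil => exact absurd rfl hv
      | @cons _ d _ h' q =>
        refine ⟨u, d, ?_, ?_, ?_⟩
        · rintro rfl
          exact hp.2 (by simp)
        · simp [Sym2.eq_swap]
        · simp
    · obtain ⟨a, b, hab, ha, hb⟩ := ih hp.1 hxp hxc hv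
      exact ⟨a, b, hab, by simp [ha], by simp [hb]⟩

theorem exists_edge_at_ends {V : Type} {G : SimpleGraph V} {u v : V}
    (p : G.Walk u v) (h : u ≠ v) :
    (∃ y, s(u, y) ∈ p.edges) ∧ ∃ y, s(v, y) ∈ p.edges := by
  have key : ∀ {a b : V} (q : G.Walk a b), a ≠ b → ∃ y, s(a, y) ∈ q.edges := by
    intro a b q hab
    cases q with
    | nil => exact absurd rfl hab
    | @cons _ c _ h q => exact ⟨c, by simp⟩
  refine ⟨key p h, ?_⟩
  obtain ⟨y, hy⟩ := key p.reverse h.symm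
  exact ⟨y, by simpa using hy⟩

/-- The local properties of a solution: terminals have degree at least one, covered nonterminals
have degree at least two, and no edge joins an `A`-path to a `B`-path. -/
theorem IsSolution.local_properties {V : Type} [DecidableEq V] {G : SimpleGraph V}
    {A B : Finset V} {E' : Set (Sym2 V)} (h : IsSolution G A B E')
    (hd : Disjoint A B) (he : Even (A.card + B.card)) :
    E' ⊆ G.edgeSet ∧ (∀ z ∈ A ∪ B, ∃ y, s(z, y) ∈ E') ∧
    (∀ z, z ∉ A ∪ B → ∀ y, s(z, y) ∈ E' → ∃ y', y' ≠ y ∧ s(z, y') ∈ E') ∧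
    ∃ T : Set V, (∀ z ∈ A, z ∈ T) ∧ (∀ z ∈ B, z ∉ T) ∧
      ∀ x y, s(x, y) ∈ E' → x ∈ T → y ∈ T := by
  obtain ⟨k, f, hk, hpath, hends, hdisj, hcov, rfl⟩ := h
  have hmemE : ∀ e, e ∈ (⋃ i, {e | e ∈ (f i).2.2.edges}) ↔ ∃ i, e ∈ (f i).2.2.edges := by
    simp
  have huniq : ∀ i j x, x ∈ (f i).2.2.support → x ∈ (f j).2.2.support → i = j := by
    intro i j x hi hj
    by_contra hij
    exact hdisj i j hij x hi hj
  have hdis : ∀ z, z ∈ A → z ∈ B → False := fun z h1 h2 =>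
    Finset.disjoint_left.mp hd h1 h2
  have hne : ∀ i, (f i).1 ≠ (f i).2.1 := by
    let g : Fin k × Bool → V := fun p => if p.2 then (f p.1).1 else (f p.1).2.1
    have himg : Finset.univ.image g = A ∪ B := by
      ext z
      simp only [Finset.mem_image, Finset.mem_univ, true_and]
      constructor
      · rintro ⟨⟨i, b⟩, rfl⟩
        have := hends i
        cases b <;> simp only [g, Finset.mem_union] <;> simp <;> tauto
      · intro hz
        obtain ⟨i, hi | hi⟩ := hcov z hz
        · exact ⟨(i, true), by simp [g, hi]⟩
        · exact ⟨(i, false), by simp [g, hi]⟩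
    have hinj : Set.InjOn g (Finset.univ : Finset (Fin k × Bool)) := by
      rw [← Finset.card_image_iff, himg, Finset.card_union_of_disjoint hd]
      simp only [Finset.card_univ, Fintype.card_prod, Fintype.card_fin, Fintype.card_bool]
      obtain ⟨r, hr⟩ := he
      omega
    intro i hi
    have hg : g (i, true) = g (i, false) := by simpa [g] using hi
    simpa using hinj (by simp) (by simp) hg
  refine ⟨?_, ?_, ?_, {x | ∃ i, x ∈ (f i).2.2.support ∧ (f i).1 ∈ A}, ?_, ?_, ?_⟩
  · intro e he
    obtain ⟨i, hi⟩ := (hmemE e).1 he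
    exact (f i).2.2.edges_subset_edgeSet hi
  · intro z hz
    obtain ⟨i, hi⟩ := hcov z hz
    obtain ⟨⟨y, hy⟩, ⟨y', hy'⟩⟩ := exists_edge_at_ends (f i).2.2 (hne i)
    rcases hi with rfl | rfl
    · exact ⟨y, (hmemE _).2 ⟨i, hy⟩⟩
    · exact ⟨y', (hmemE _).2 ⟨i, hy'⟩⟩
  · intro z hz y hy
    obtain ⟨i, hi⟩ := (hmemE _).1 hy
    have hnot := hends i
    rw [Finset.mem_union] at hz
    obtain ⟨a, b, hab, ha, hb⟩ := exists_two_edges_of_mem_support (f i).2.2 (hpath i)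
      ((f i).2.2.fst_mem_support_of_mem_edges hi)
      (by rintro rfl; tauto) (by rintro rfl; tauto)
    by_cases hay : a = y
    · exact ⟨b, fun hby => hab (hay.trans hby.symm), (hmemE _).2 ⟨i, hb⟩⟩
    · exact ⟨a, hay, (hmemE _).2 ⟨i, ha⟩⟩
  · intro z hz
    obtain ⟨i, hi⟩ := hcov z (Finset.mem_union_left _ hz)
    have h1 := hends i
    have h2 := hdis z hz
    rcases hi with rfl | rfl
    · exact ⟨i, by simp, hz⟩
    · exact ⟨i, by simp, by tauto⟩
  · rintro z hz ⟨i, hi, hiA⟩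
    obtain ⟨j, hj⟩ := hcov z (Finset.mem_union_right _ hz)
    have hji : j = i := huniq j i z (by rcases hj with rfl | rfl <;> simp) hi
    subst hji
    have h1 := hends j
    have h2 := hdis _ hiA
    rcases hj with rfl | rfl
    · exact hdis _ hiA hz
    · exact hdis _ (by tauto) hz
  · rintro x y hxy ⟨i, hi, hiA⟩
    obtain ⟨j, hj⟩ := (hmemE _).1 hxy
    have hji := huniq j i x ((f j).2.2.fst_mem_support_of_mem_edges hj) hi
    subst hji
    exact ⟨j, (f j).2.2.snd_mem_support_of_mem_edges hj, hiA⟩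

/-- A family of disjoint paths indexed by any finite type yields a solution. -/
theorem exists_isSolution_lengthOf_le {V ι : Type} [DecidableEq V] [Fintype ι]
    {G : SimpleGraph V} {A B : Finset V} (ℓ : Sym2 V → ℕ) (c : ι → ℕ)
    (hcard : Fintype.card ι = (A.card + B.card) / 2)
    (f : ι → (u : V) × (v : V) × G.Walk u v)
    (hpath : ∀ i, (f i).2.2.IsPath)
    (hends : ∀ i, ((f i).1 ∈ A ∧ (f i).2.1 ∈ A) ∨ ((f i).1 ∈ B ∧ (f i).2.1 ∈ B))
    (hdisj : ∀ i j x, x ∈ (f i).2.2.support → x ∈ (f j).2.2.support → i = j)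
    (hcov : ∀ z, z ∈ A ∪ B → ∃ i, z = (f i).1 ∨ z = (f i).2.1)
    (hc : ∀ i, ((f i).2.2.edges.map ℓ).sum ≤ c i) :
    ∃ E', IsSolution G A B E' ∧ lengthOf ℓ E' ≤ ∑ i, c i := by
  classical
  let φ : Fin (Fintype.card ι) ≃ ι := (Fintype.equivFin ι).symm
  refine ⟨⋃ i, {e | e ∈ (f i).2.2.edges}, ⟨Fintype.card ι, f ∘ φ, hcard, fun i => hpath _,
    fun i => hends _, fun i j hij x hi hj => hij (φ.injective (hdisj _ _ x hi hj)), ?_, ?_⟩, ?_⟩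
  · intro z hz
    obtain ⟨i, hi⟩ := hcov z hz
    obtain ⟨j, rfl⟩ := φ.surjective i
    exact ⟨j, hi⟩
  · exact (φ.surjective.iUnion_comp fun i => {e | e ∈ (f i).2.2.edges}).symm
  · have hE : (⋃ i, {e | e ∈ (f i).2.2.edges}) =
        ((Finset.univ.biUnion fun i => (f i).2.2.edges.toFinset : Finset (Sym2 V)) :
          Set (Sym2 V)) := by
      ext e; simp
    rw [lengthOf, hE, finsum_mem_coe_finset]
    rw [Finset.sum_biUnion]
    · refine Finset.sum_le_sum fun i _ => ?_
      rw [List.sum_toFinset _ (hpath i).isTrail.edges_nodup]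
      exact hc i
    · intro i _ j _ hij
      refine Finset.disjoint_left.2 fun e hi hj => hij ?_
      induction e with
      | _ x y =>
        rw [List.mem_toFinset] at hi hj
        exact hdisj i j x ((f i).2.2.fst_mem_support_of_mem_edges hi)
          ((f j).2.2.fst_mem_support_of_mem_edges hj)

theorem sum_le_lengthOf {V ι : Type} [Finite V] [Fintype ι] (ℓ : Sym2 V → ℕ)
    (E' : Set (Sym2 V)) [DecidablePred (· ∈ E')] (d : ι → Sym2 V)
    (hd : Function.Injective d) :
    ∑ j, (if d j ∈ E' then ℓ (d j) else 0) ≤ lengthOf ℓ E' := by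
  classical
  have hfin : E'.Finite := Set.toFinite E'
  have hlen : lengthOf ℓ E' = ∑ e ∈ hfin.toFinset, ℓ e := by
    rw [lengthOf, ← finsum_mem_coe_finset, hfin.coe_toFinset]
  rw [hlen, ← Finset.sum_filter, ← Finset.sum_image (f := ℓ) (g := d) hd.injOn]
  refine Finset.sum_le_sum_of_subset fun e he => ?_
  simp only [Finset.mem_image, Finset.mem_filter, Finset.mem_univ,
    true_and] at he
  obtain ⟨j, hj, rfl⟩ := he
  simpa using hj

section Instance

variable {V : Type} {G : SimpleGraph V} {σ : V → Sym2 V → ℕ} {fs sn : Sym2 V → V}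

theorem instGraph_adj_inl_inl {v w : V} {i j : Fin 8} :
    (instGraph G σ fs sn).Adj (.inl (v, i)) (.inl (w, j)) ↔
      v = w ∧ (j = i + 1 ∨ i = j + 1) := by
  have key : ∀ i j : Fin 8, (i ≠ j ∧ ((i.val + 1 = j.val ∨ (i.val = 7 ∧ j.val = 0)) ∨
      (j.val + 1 = i.val ∨ (j.val = 7 ∧ i.val = 0)))) ↔ (j = i + 1 ∨ i = j + 1) := by
    decide
  rw [← key i j]
  simp only [instGraph, SimpleGraph.fromRel_adj, iRel, ne_eq, Sum.inl.injEq, Prod.mk.injEq]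
  constructor
  · rintro ⟨h, ⟨rfl, h'⟩ | ⟨rfl, h'⟩⟩ <;> tauto
  · rintro ⟨rfl, h⟩
    tauto

theorem instGraph_adj_inr_inl {z : Sym2 V × Fin 2} {p : V × Fin 8} :
    (instGraph G σ fs sn).Adj (.inr z) (.inl p) ↔ iRel G σ fs sn (.inr z) (.inl p) := by
  simp [instGraph, iRel]

theorem not_instGraph_adj_inr_inr {z z' : Sym2 V × Fin 2} :
    ¬ (instGraph G σ fs sn).Adj (.inr z) (.inr z') := by
  simp [instGraph, iRel]

/-- The length of the `i`-th edge of a gadget cycle. -/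
def cycleLen : Fin 8 → ℕ := ![2, 1, 2, 1, 2, 1, 2, 12]

theorem instLen_inl_inl (v : V) {i j : Fin 8} (h : j = i + 1) :
    instLen s((.inl (v, i) : IVert V), .inl (v, j)) = cycleLen i := by
  subst h
  have h1 : (∃ w : V, s((.inl (v, i) : IVert V), .inl (v, i + 1)) =
      s((.inl (w, 7) : IVert V), .inl (w, 0))) ↔ i = 7 := by
    have key : ∀ i : Fin 8, (i = 7 ∧ i + 1 = 0 ∨ i = 0 ∧ i + 1 = 7) ↔ i = 7 := by decide
    rw [← key i]
    constructor
    · rintro ⟨w, hw⟩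
      simp only [Sym2.eq_iff, Sum.inl.injEq, Prod.mk.injEq] at hw
      tauto
    · intro h
      exact ⟨v, by simp only [Sym2.eq_iff, Sum.inl.injEq, Prod.mk.injEq]; tauto⟩
  have h2 : (∃ (w : V) (a b : Fin 8), a.val % 2 = 0 ∧ a.val + 1 = b.val ∧
      s((.inl (v, i) : IVert V), .inl (v, i + 1)) = s((.inl (w, a) : IVert V), .inl (w, b))) ↔
      i.val % 2 = 0 := by
    have key : ∀ i : Fin 8, (∃ a b : Fin 8, a.val % 2 = 0 ∧ a.val + 1 = b.val ∧
      (i = a ∧ i + 1 = b ∨ i = b ∧ i + 1 = a)) ↔ i.val % 2 = 0 := by decide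
    rw [← key i]
    constructor
    · rintro ⟨w, a, b, ha, hb, hw⟩
      simp only [Sym2.eq_iff, Sum.inl.injEq, Prod.mk.injEq] at hw
      exact ⟨a, b, ha, hb, by tauto⟩
    · rintro ⟨a, b, ha, hb, h⟩
      exact ⟨v, a, b, ha, hb, by
        simp only [Sym2.eq_iff, Sum.inl.injEq, Prod.mk.injEq]; tauto⟩
  simp only [instLen, h1, h2]
  clear h1 h2
  revert i
  decide

theorem instLen_inr_inl (z : Sym2 V × Fin 2) (p : V × Fin 8) :
    instLen s((.inr z : IVert V), .inl p) = 1 := by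
  simp [instLen]

theorem instLen_inl_inr (z : Sym2 V × Fin 2) (p : V × Fin 8) :
    instLen s((.inl p : IVert V), .inr z) = 1 := by
  rw [Sym2.eq_swap, instLen_inr_inl]

section Terminals

variable [Fintype V] [DecidableEq V] [DecidableRel G.Adj]

theorem mem_instA {x : IVert V} : x ∈ instA V ↔ ∃ v, x = .inl (v, 0) ∨ x = .inl (v, 7) := by
  simp only [instA, Finset.mem_union, Finset.mem_image, Finset.mem_univ, true_and,
    exists_or, eq_comm]

theorem mem_instB {x : IVert V} : x ∈ instB G ↔ ∃ e ∈ G.edgeSet, ∃ k, x = .inr (e, k) := by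
  simp only [instB, Finset.mem_union, Finset.mem_image, SimpleGraph.mem_edgeFinset]
  constructor
  · rintro (⟨e, he, rfl⟩ | ⟨e, he, rfl⟩)
    exacts [⟨e, he, 0, rfl⟩, ⟨e, he, 1, rfl⟩]
  · rintro ⟨e, he, k, rfl⟩
    fin_cases k
    exacts [.inl ⟨e, he, rfl⟩, .inr ⟨e, he, rfl⟩]

theorem disjoint_instA_instB : Disjoint (instA V) (instB G) := by
  refine Finset.disjoint_left.2 fun x hA hB => ?_
  obtain ⟨v, hv⟩ := mem_instA.1 hA
  obtain ⟨e, -, k, rfl⟩ := mem_instB.1 hB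
  simp at hv

theorem card_instA : (instA V).card = 2 * Fintype.card V := by
  rw [instA, Finset.card_union_of_disjoint, Finset.card_image_of_injective,
    Finset.card_image_of_injective, Finset.card_univ, two_mul]
  · intro a b h; simpa using h
  · intro a b h; simpa using h
  · simp [Finset.disjoint_left]

theorem card_instB : (instB G).card = 2 * G.edgeFinset.card := by
  rw [instB, Finset.card_union_of_disjoint, Finset.card_image_of_injective,
    Finset.card_image_of_injective, two_mul]
  · intro a b h; simpa using h
  · intro a b h; simpa using h
  · simp [Finset.disjoint_left]

end Terminals

/-- Each gadget vertex has at most one neighbour among the edge-gadget vertices. -/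
theorem iRel_inr_inl_unique (hfssn : ∀ e ∈ G.edgeSet, e = s(fs e, sn e))
    (hσmem : ∀ v : V, ∀ e ∈ G.incidenceSet v, σ v e = 2 ∨ σ v e = 4 ∨ σ v e = 6)
    (hσinj : ∀ v : V, Set.InjOn (σ v) (G.incidenceSet v))
    {z z' : Sym2 V × Fin 2} {p : V × Fin 8}
    (h : iRel G σ fs sn (.inr z) (.inl p)) (h' : iRel G σ fs sn (.inr z') (.inl p)) :
    z = z' := by
  obtain ⟨e, k⟩ := z
  obtain ⟨e', k'⟩ := z'
  obtain ⟨w, i⟩ := p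
  obtain ⟨he, h⟩ := h
  obtain ⟨he', h'⟩ := h'
  have hmem : ∀ e ∈ G.edgeSet, w = fs e ∨ w = sn e → e ∈ G.incidenceSet w := by
    intro e he hw
    refine ⟨he, ?_⟩
    rw [hfssn e he]
    simpa using hw
  have hwe := hmem e he (by tauto)
  have hwe' := hmem e' he' (by tauto)
  have h1 := hσmem w e hwe
  have h2 := hσmem w e' hwe'
  have hee : e = e' := hσinj w hwe hwe' (by omega)
  subst hee
  have hne : fs e ≠ sn e := by
    intro hs
    have h3 := hfssn e he
    rw [h3, SimpleGraph.mem_edgeSet, hs] at he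
    exact G.loopless.irrefl _ he
  rw [Prod.mk.injEq]
  refine ⟨rfl, ?_⟩
  rcases h with ⟨rfl, hw, h⟩ | ⟨rfl, hw, h⟩ | ⟨rfl, hw, h⟩ | ⟨rfl, hw, h⟩ <;>
  rcases h' with ⟨rfl, hw', h'⟩ | ⟨rfl, hw', h'⟩ | ⟨rfl, hw', h'⟩ | ⟨rfl, hw', h'⟩ <;>
  first
  | rfl
  | exact absurd (hw.symm.trans hw') hne
  | exact absurd (hw'.symm.trans hw) hne
  | omega

theorem iRel_inr_inl_ne (hfssn : ∀ e ∈ G.edgeSet, e = s(fs e, sn e))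
    (hσmem : ∀ v : V, ∀ e ∈ G.incidenceSet v, σ v e = 2 ∨ σ v e = 4 ∨ σ v e = 6)
    {e : Sym2 V} {k : Fin 2} {w : V} {i : Fin 8}
    (h : iRel G σ fs sn (.inr (e, k)) (.inl (w, i))) :
    w ∈ e ∧ i ≠ 0 ∧ i ≠ 7 := by
  obtain ⟨he, h⟩ := h
  have hw : w ∈ e := by
    rw [hfssn e he, Sym2.mem_iff]
    tauto
  have h1 := hσmem w e ⟨he, hw⟩
  refine ⟨hw, ?_, ?_⟩ <;> rintro rfl <;> simp at h <;> omega

end Instance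

theorem gadget_inequality (x y : Fin 8 → ℕ) (s : ℕ) (hy : ∀ i, y i ≤ x (i - 1) + x i)
    (hy0 : y 0 = 0) (hy7 : y 7 = 0)
    (h : x 7 = 1 ∨ (s = 1 ∧ (∀ i, i ≠ 7 → x i = 1) ∧ ∀ i, y i = 0)) :
    24 + ∑ i, y i ≤ 2 * ∑ i, cycleLen i * x i + 2 * s := by
  have h1 := hy 1
  have h2 := hy 2
  have h3 := hy 3
  have h4 := hy 4
  have h5 := hy 5
  have h6 := hy 6
  simp only [Fin.sum_univ_eight, cycleLen]
  simp at h1 h2 h3 h4 h5 h6 ⊢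
  rcases h with h | ⟨rfl, hx, hy'⟩
  · omega
  · simp only [hy', hx 0 (by decide), hx 1 (by decide), hx 2 (by decide), hx 3 (by decide),
      hx 4 (by decide), hx 5 (by decide), hx 6 (by decide)]
    omega

theorem bddAbove_indepNum {V : Type} [Fintype V] (G : SimpleGraph V) :
    BddAbove {n | ∃ S : Finset V, (∀ u ∈ S, ∀ w ∈ S, ¬ G.Adj u w) ∧ S.card = n} := by
  refine ⟨Fintype.card V, ?_⟩
  rintro n ⟨S, -, rfl⟩
  exact S.card_le_univ

theorem card_le_indepNum {V : Type} [Fintype V] {G : SimpleGraph V} {S : Finset V}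
    (hS : ∀ u ∈ S, ∀ w ∈ S, ¬ G.Adj u w) : S.card ≤ indepNum G :=
  le_csSup (bddAbove_indepNum G) ⟨S, hS, rfl⟩

theorem exists_card_eq_indepNum {V : Type} [Fintype V] (G : SimpleGraph V) :
    ∃ S : Finset V, (∀ u ∈ S, ∀ w ∈ S, ¬ G.Adj u w) ∧ S.card = indepNum G :=
  Nat.sSup_mem (s := {n | ∃ S : Finset V, (∀ u ∈ S, ∀ w ∈ S, ¬ G.Adj u w) ∧ S.card = n})
    ⟨0, ∅, by simp⟩ (bddAbove_indepNum G)

section Paths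

variable {V : Type} {G : SimpleGraph V} {σ : V → Sym2 V → ℕ} {fs sn : Sym2 V → V}

theorem exists_gadget_path (σ : V → Sym2 V → ℕ) (fs sn : Sym2 V → V) (S : Finset V)
    [DecidablePred (· ∈ S)] (v : V) :
    ∃ p : (instGraph G σ fs sn).Walk (.inl (v, 0)) (.inl (v, 7)), p.IsPath ∧
      (∀ x ∈ p.support, ∃ i, x = .inl (v, i) ∧ (v ∈ S ∨ i = 0 ∨ i = 7)) ∧
      (p.edges.map instLen).sum ≤ if v ∈ S then 11 else 12 := by
  have hadj : ∀ i j : Fin 8, j = i + 1 →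
      (instGraph G σ fs sn).Adj (.inl (v, i)) (.inl (v, j)) := fun i j h =>
    instGraph_adj_inl_inl.2 ⟨rfl, .inl h⟩
  by_cases hv : v ∈ S
  · refine ⟨.cons (hadj 0 1 rfl) <| .cons (hadj 1 2 rfl) <| .cons (hadj 2 3 rfl) <|
      .cons (hadj 3 4 rfl) <| .cons (hadj 4 5 rfl) <| .cons (hadj 5 6 rfl) <|
      .cons (hadj 6 7 rfl) .nil, ?_, ?_, ?_⟩
    · simp [SimpleGraph.Walk.cons_isPath_iff]
    · simp [hv]
    · simp only [SimpleGraph.Walk.edges_cons, SimpleGraph.Walk.edges_nil, List.map_cons,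
        List.map_nil, List.sum_cons, List.sum_nil, hv, if_true]
      rw [instLen_inl_inl v (i := 0) (j := 1) rfl,
        instLen_inl_inl v (i := 1) (j := 2) rfl,
        instLen_inl_inl v (i := 2) (j := 3) rfl,
        instLen_inl_inl v (i := 3) (j := 4) rfl,
        instLen_inl_inl v (i := 4) (j := 5) rfl,
        instLen_inl_inl v (i := 5) (j := 6) rfl,
        instLen_inl_inl v (i := 6) (j := 7) rfl]
      decide
  · refine ⟨.cons (hadj 7 0 rfl).symm .nil, ?_, ?_, ?_⟩
    · simp [SimpleGraph.Walk.cons_isPath_iff]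
    · simp
    · simp only [SimpleGraph.Walk.edges_cons, SimpleGraph.Walk.edges_nil, List.map_cons,
        List.map_nil, List.sum_cons, List.sum_nil, hv, if_false]
      rw [Sym2.eq_swap, instLen_inl_inl v (i := 7) (j := 0) rfl]
      decide

theorem exists_edge_path
    (hfssn : ∀ e ∈ G.edgeSet, e = s(fs e, sn e))
    (hσmem : ∀ v : V, ∀ e ∈ G.incidenceSet v, σ v e = 2 ∨ σ v e = 4 ∨ σ v e = 6)
    {S : Finset V} (hS : ∀ u ∈ S, ∀ w ∈ S, ¬ G.Adj u w) {e : Sym2 V} (he : e ∈ G.edgeSet) :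
    ∃ p : (instGraph G σ fs sn).Walk (.inr (e, 0)) (.inr (e, 1)), p.IsPath ∧
      (∀ x ∈ p.support, (∃ k, x = .inr (e, k)) ∨ ∃ (u : V) (i : Fin 8), x = .inl (u, i) ∧
        u ∉ S ∧ i ≠ 0 ∧ i ≠ 7 ∧ e ∈ G.incidenceSet u ∧
        (i.val = σ u e ∨ i.val + 1 = σ u e)) ∧
      (p.edges.map instLen).sum ≤ 3 := by
  obtain ⟨u, i, j, huS, hij, hlen, hi, hj⟩ : ∃ (u : V) (i j : Fin 8), u ∉ S ∧
      (j = i + 1 ∨ i = j + 1) ∧ instLen s((.inl (u, i) : IVert V), .inl (u, j)) = 1 ∧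
      iRel G σ fs sn (.inr (e, 0)) (.inl (u, i)) ∧
      iRel G σ fs sn (.inr (e, 1)) (.inl (u, j)) := by
    have hex : ∃ u, (u = fs e ∨ u = sn e) ∧ u ∉ S := by
      by_contra! hcon
      refine hS _ (hcon _ (.inl rfl)) _ (hcon _ (.inr rfl)) ?_
      rw [← SimpleGraph.mem_edgeSet, ← hfssn e he]
      exact he
    obtain ⟨u, hu, huS⟩ := hex
    have hmem : e ∈ G.incidenceSet u := by
      refine ⟨he, ?_⟩
      rw [hfssn e he]
      simpa using hu
    obtain ⟨a, ha, hla⟩ : ∃ a : Fin 8, (a.val + 1 = σ u e ∧ (a + 1).val = σ u e) ∧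
        cycleLen a = 1 := by
      rcases hσmem u e hmem with h | h | h <;> rw [h]
      exacts [⟨1, by decide⟩, ⟨3, by decide⟩, ⟨5, by decide⟩]
    rcases hu with hu | hu
    · exact ⟨u, a, a + 1, huS, .inl rfl, by rw [instLen_inl_inl u rfl, hla],
        ⟨he, by tauto⟩, ⟨he, by tauto⟩⟩
    · exact ⟨u, a + 1, a, huS, .inr rfl, by rw [Sym2.eq_swap, instLen_inl_inl u rfl, hla],
        ⟨he, by tauto⟩, ⟨he, by tauto⟩⟩
  have hne : i ≠ j := by
    rcases hij with rfl | rfl <;> simp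
  have hi' := iRel_inr_inl_ne hfssn hσmem hi
  have hj' := iRel_inr_inl_ne hfssn hσmem hj
  refine ⟨.cons (instGraph_adj_inr_inl.2 hi) <|
    .cons (instGraph_adj_inl_inl.2 ⟨rfl, hij⟩) <|
    .cons (instGraph_adj_inr_inl.2 hj).symm .nil, ?_, ?_, ?_⟩
  · simp [SimpleGraph.Walk.cons_isPath_iff, hne]
  · intro x hx
    simp only [SimpleGraph.Walk.support_cons, SimpleGraph.Walk.support_nil, List.mem_cons,
      List.not_mem_nil, or_false] at hx
    rcases hx with rfl | rfl | rfl | rfl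
    · exact .inl ⟨0, rfl⟩
    · refine .inr ⟨u, i, rfl, huS, hi'.2.1, hi'.2.2, ⟨he, hi'.1⟩, ?_⟩
      have := hi.2
      tauto
    · refine .inr ⟨u, j, rfl, huS, hj'.2.1, hj'.2.2, ⟨he, hj'.1⟩, ?_⟩
      have := hj.2
      tauto
    · exact .inl ⟨1, rfl⟩
  · simp only [SimpleGraph.Walk.edges_cons, SimpleGraph.Walk.edges_nil, List.map_cons,
      List.map_nil, List.sum_cons, List.sum_nil, hlen, instLen_inr_inl, instLen_inl_inr]
    omega

end Paths

section Bounds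

variable {V : Type} [Fintype V] [DecidableEq V] {G : SimpleGraph V} [DecidableRel G.Adj]
  {σ : V → Sym2 V → ℕ} {fs sn : Sym2 V → V}

theorem le_lengthOf_of_isSolution
    (hfssn : ∀ e ∈ G.edgeSet, e = s(fs e, sn e))
    (hσmem : ∀ v : V, ∀ e ∈ G.incidenceSet v, σ v e = 2 ∨ σ v e = 4 ∨ σ v e = 6)
    (hσinj : ∀ v : V, Set.InjOn (σ v) (G.incidenceSet v))
    {E' : Set (Sym2 (IVert V))}
    (h : IsSolution (instGraph G σ fs sn) (instA V) (instB G) E') :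
    12 * Fintype.card V + 3 * G.edgeFinset.card ≤ lengthOf instLen E' + indepNum G := by
  classical
  obtain ⟨hsub, hterm, hnonterm, T, hTA, hTB, hT⟩ := h.local_properties disjoint_instA_instB
    (by rw [card_instA, card_instB]; simp [parity_simps])
  have hadj : ∀ {x y}, s(x, y) ∈ E' → (instGraph G σ fs sn).Adj x y := fun h => hsub h
  let X : V → Fin 8 → Prop := fun v i => s((.inl (v, i) : IVert V), .inl (v, i + 1)) ∈ E'
  have hnbr : ∀ z : G.edgeSet × Fin 2, ∃ p : V × Fin 8,
      s((.inr (z.1.1, z.2) : IVert V), .inl p) ∈ E' := by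
    rintro ⟨⟨e, he⟩, k⟩
    obtain ⟨y, hy⟩ := hterm (.inr (e, k))
      (Finset.mem_union_right _ (mem_instB.2 ⟨e, he, k, rfl⟩))
    rcases y with p | z
    · exact ⟨p, hy⟩
    · exact absurd (hadj hy) not_instGraph_adj_inr_inr
  choose n hn using hnbr
  have hrel : ∀ z, iRel G σ fs sn (.inr (z.1.1, z.2)) (.inl (n z)) := fun z =>
    instGraph_adj_inr_inl.1 (hadj (hn z))
  have hninj : Function.Injective n := by
    intro z z' hz
    have h1 := hrel z
    rw [hz] at h1
    have h2 := iRel_inr_inl_unique hfssn hσmem hσinj h1 (hrel z')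
    rw [Prod.mk.injEq] at h2
    exact Prod.ext (Subtype.ext h2.1) h2.2
  have hends : ∀ z i, i = 0 ∨ i = 7 → ∀ v, ¬ iRel G σ fs sn (.inr z) (.inl (v, i)) := by
    rintro ⟨e, k⟩ i hi v h
    have := iRel_inr_inl_ne hfssn hσmem h
    tauto
  have hnot : ∀ v i, i ≠ 0 → i ≠ 7 → (.inl (v, i) : IVert V) ∉ instA V ∪ instB G := by
    intro v i h0 h7 hm
    rcases Finset.mem_union.1 hm with hm | hm
    · obtain ⟨w, hw⟩ := mem_instA.1 hm
      simp [h0, h7] at hw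
    · obtain ⟨e, -, k, hk⟩ := mem_instB.1 hm
      simp at hk
  have hcyc : ∀ v i w j, s((.inl (v, i) : IVert V), .inl (w, j)) ∈ E' →
      w = v ∧ (j = i + 1 ∧ X v i ∨ j = i - 1 ∧ X v (i - 1)) := by
    intro v i w j hE
    obtain ⟨rfl, rfl | rfl⟩ := instGraph_adj_inl_inl.1 (hadj hE)
    · exact ⟨rfl, .inl ⟨rfl, hE⟩⟩
    · refine ⟨rfl, .inr ⟨by simp, ?_⟩⟩
      simp only [X, add_sub_cancel_right]
      rwa [Sym2.eq_swap]
  have hused : ∀ z, X (n z).1 ((n z).2 - 1) ∨ X (n z).1 (n z).2 := by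
    intro z
    have hne := iRel_inr_inl_ne hfssn hσmem (hrel z)
    have hE := hn z
    rw [Sym2.eq_swap] at hE
    obtain ⟨y, hy, hyE⟩ := hnonterm _ (hnot _ _ hne.2.1 hne.2.2) _ hE
    rcases y with ⟨w, j⟩ | z'
    · have := hcyc _ _ _ _ hyE
      tauto
    · rw [Sym2.eq_swap] at hyE
      have := iRel_inr_inl_unique hfssn hσmem hσinj (instGraph_adj_inr_inl.1 (hadj hyE)) (hrel z)
      rw [this] at hy
      exact absurd rfl hy
  have hnT : ∀ z, (.inl (n z) : IVert V) ∉ T := fun z hz =>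
    hTB _ (mem_instB.2 ⟨z.1.1, z.1.2, z.2, rfl⟩) (hT _ _ (by rw [Sym2.eq_swap]; exact hn z) hz)
  have hstart : ∀ v, ¬ X v 7 → X v 0 := by
    intro v hv
    obtain ⟨y, hy⟩ := hterm (.inl (v, 0))
      (Finset.mem_union_left _ (mem_instA.2 ⟨v, .inl rfl⟩))
    rcases y with ⟨w, j⟩ | z
    · obtain ⟨-, ⟨-, h⟩ | ⟨-, h⟩⟩ := hcyc _ _ _ _ hy
      · exact h
      · exact absurd h hv
    · rw [Sym2.eq_swap] at hy
      exact absurd (instGraph_adj_inr_inl.1 (hadj hy)) (hends _ _ (.inl rfl) _)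
  have hstep : ∀ v i, i + 1 ≠ 0 → i + 1 ≠ 7 → (.inl (v, i) : IVert V) ∈ T → X v i →
      (.inl (v, i + 1) : IVert V) ∈ T ∧ X v (i + 1) := by
    intro v i h0 h7 hiT hX
    have hmem := hT _ _ hX hiT
    refine ⟨hmem, ?_⟩
    have hX' : s((.inl (v, i + 1) : IVert V), .inl (v, i)) ∈ E' := by
      rw [Sym2.eq_swap]
      exact hX
    obtain ⟨y, hy, hyE⟩ := hnonterm _ (hnot v _ h0 h7) _ hX'
    rcases y with ⟨w, j⟩ | ⟨e, k⟩
    · obtain ⟨rfl, ⟨-, h⟩ | ⟨rfl, h⟩⟩ := hcyc _ _ _ _ hyE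
      · exact h
      · simp at hy
    · have hrel' := instGraph_adj_inr_inl.1 (hadj hyE).symm
      exact absurd (hT _ _ hyE hmem) (hTB _ (mem_instB.2 ⟨e, hrel'.1, k, rfl⟩))
  have hlong : ∀ v, ¬ X v 7 → (∀ i, i ≠ 7 → X v i) ∧ ∀ i, (.inl (v, i) : IVert V) ∈ T := by
    intro v hv
    have t0 : (.inl (v, 0) : IVert V) ∈ T := hTA _ (mem_instA.2 ⟨v, .inl rfl⟩)
    have t7 : (.inl (v, 7) : IVert V) ∈ T := hTA _ (mem_instA.2 ⟨v, .inr rfl⟩)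
    have x0 := hstart v hv
    obtain ⟨t1, x1⟩ := hstep v 0 (by decide) (by decide) t0 x0
    obtain ⟨t2, x2⟩ := hstep v 1 (by decide) (by decide) t1 x1
    obtain ⟨t3, x3⟩ := hstep v 2 (by decide) (by decide) t2 x2
    obtain ⟨t4, x4⟩ := hstep v 3 (by decide) (by decide) t3 x3
    obtain ⟨t5, x5⟩ := hstep v 4 (by decide) (by decide) t4 x4
    obtain ⟨t6, x6⟩ := hstep v 5 (by decide) (by decide) t5 x5
    constructor
    · intro i hi
      fin_cases i
      exacts [x0, x1, x2, x3, x4, x5, x6, absurd rfl hi]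
    · intro i
      fin_cases i
      exacts [t0, t1, t2, t3, t4, t5, t6, t7]
  let S : Finset V := Finset.univ.filter fun v => ¬ X v 7
  have hS : S.card ≤ indepNum G := by
    refine card_le_indepNum fun u hu w hw huw => ?_
    have hu' := (hlong u (by simpa [S] using hu)).2
    have hw' := (hlong w (by simpa [S] using hw)).2
    let z : G.edgeSet × Fin 2 := (⟨s(u, w), huw⟩, 0)
    have hz := (iRel_inr_inl_ne hfssn hσmem (hrel z)).1
    have hzT := hnT z
    rcases Sym2.mem_iff.1 hz with h | h
    · exact hzT (by have := hu' (n z).2; rwa [← h] at this)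
    · exact hzT (by have := hw' (n z).2; rwa [← h] at this)
  let x : V → Fin 8 → ℕ := fun v i => if X v i then 1 else 0
  let y : V → Fin 8 → ℕ := fun v i => if (v, i) ∈ Finset.univ.image n then 1 else 0
  have hy0 : ∀ v i, ¬ (∃ z, n z = (v, i)) → y v i = 0 := by
    intro v i h
    simp only [y]
    rw [if_neg]
    simpa using h
  have hgadget : ∀ v, 24 + ∑ i, y v i ≤
      2 * ∑ i, cycleLen i * x v i + 2 * if v ∈ S then 1 else 0 := by
    intro v
    refine gadget_inequality _ _ _ ?_ ?_ ?_ ?_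
    · intro i
      by_cases hi : ∃ z, n z = (v, i)
      · obtain ⟨z, hz⟩ := hi
        have h1 : y v i ≤ 1 := by simp only [y]; split_ifs <;> omega
        have h2 := hused z
        rw [hz] at h2
        rcases h2 with h2 | h2 <;> simp only [x, h2, if_true] <;> omega
      · rw [hy0 v i hi]; omega
    · refine hy0 _ _ ?_
      rintro ⟨z, hz⟩
      exact hends _ _ (.inl rfl) v (hz ▸ hrel z)
    · refine hy0 _ _ ?_
      rintro ⟨z, hz⟩
      exact hends _ _ (.inr rfl) v (hz ▸ hrel z)
    · by_cases hv : X v 7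
      · exact .inl (by simp [x, hv])
      · obtain ⟨hX, hTv⟩ := hlong v hv
        refine .inr ⟨by simp [S, hv], fun i hi => by simp [x, hX i hi], fun i => hy0 _ _ ?_⟩
        rintro ⟨z, hz⟩
        exact hnT z (hz ▸ hTv i)
  have hysum : ∑ v, ∑ i, y v i = 2 * G.edgeFinset.card := by
    rw [← Fintype.sum_prod_type' (f := fun v i => y v i)]
    simp only [y, Prod.mk.eta]
    rw [Finset.sum_boole, Finset.filter_univ_mem, Finset.card_image_of_injective _ hninj]
    simp [SimpleGraph.edgeFinset_card, mul_comm]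
  have hlen : (∑ v, ∑ i, cycleLen i * x v i) + 2 * G.edgeFinset.card ≤ lengthOf instLen E' := by
    let d : (V × Fin 8) ⊕ (G.edgeSet × Fin 2) → Sym2 (IVert V) :=
      Sum.elim (fun p => s(.inl p, .inl (p.1, p.2 + 1)))
        (fun z => s(.inr (z.1.1, z.2), .inl (n z)))
    have hd : Function.Injective d := by
      have key : ∀ i j : Fin 8, i = j + 1 → i + 1 = j → False := by decide
      rintro (⟨v, i⟩ | z) (⟨w, j⟩ | z') hdd
      · simp only [d, Sum.elim_inl, Sym2.eq_iff, Sum.inl.injEq, Prod.mk.injEq] at hdd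
        have := key i j
        have hvi : v = w ∧ i = j := by tauto
        rw [hvi.1, hvi.2]
      · simp [d] at hdd
      · simp [d] at hdd
      · simp only [d, Sum.elim_inr, Sym2.eq_iff, Sum.inr.injEq, Prod.mk.injEq, reduceCtorEq,
          and_false, or_false] at hdd
        exact congrArg Sum.inr (Prod.ext (Subtype.ext hdd.1.1) hdd.1.2)
    refine le_trans (le_of_eq ?_) (sum_le_lengthOf instLen E' d hd)
    rw [Fintype.sum_sum_type, Fintype.sum_prod_type]
    congr 1
    · refine Finset.sum_congr rfl fun v _ => Finset.sum_congr rfl fun i _ => ?_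
      simp only [d, Sum.elim_inl, instLen_inl_inl v rfl, x, X, mul_ite, mul_one, mul_zero]
    · simp only [d, Sum.elim_inr, hn, if_true, instLen_inr_inl]
      simp [SimpleGraph.edgeFinset_card, mul_comm]
  have htotal := Finset.sum_le_sum fun v (_ : v ∈ Finset.univ) => hgadget v
  simp only [Finset.sum_add_distrib, ← Finset.mul_sum, hysum] at htotal
  simp only [Finset.sum_const, Finset.card_univ, smul_eq_mul, Finset.sum_ite_mem,
    Finset.univ_inter, mul_one] at htotal
  omega

theorem exists_isSolution_of_independent
    (hfssn : ∀ e ∈ G.edgeSet, e = s(fs e, sn e))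
    (hσmem : ∀ v : V, ∀ e ∈ G.incidenceSet v, σ v e = 2 ∨ σ v e = 4 ∨ σ v e = 6)
    (hσinj : ∀ v : V, Set.InjOn (σ v) (G.incidenceSet v))
    {S : Finset V} (hS : ∀ u ∈ S, ∀ w ∈ S, ¬ G.Adj u w) :
    ∃ E', IsSolution (instGraph G σ fs sn) (instA V) (instB G) E' ∧
      lengthOf instLen E' + S.card ≤ 12 * Fintype.card V + 3 * G.edgeFinset.card := by
  choose p hp hpsupp hplen using exists_gadget_path (G := G) σ fs sn S
  choose q hq hqsupp hqlen using
    fun e : G.edgeSet => exists_edge_path (σ := σ) hfssn hσmem hS e.2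
  obtain ⟨E', hE', hlen⟩ := exists_isSolution_lengthOf_le (ι := V ⊕ G.edgeSet)
    (G := instGraph G σ fs sn) (A := instA V) (B := instB G) instLen
    (Sum.elim (fun v => if v ∈ S then 11 else 12) fun _ => 3)
    (by
      rw [card_instA, card_instB, Fintype.card_sum, SimpleGraph.edgeFinset_card]
      omega)
    (Sum.elim (fun v => ⟨_, _, p v⟩) fun e => ⟨_, _, q e⟩)
    (by rintro (v | e) <;> simp [hp, hq])
    (by
      rintro (v | e)
      · exact .inl ⟨mem_instA.2 ⟨v, .inl rfl⟩, mem_instA.2 ⟨v, .inr rfl⟩⟩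
      · exact .inr ⟨mem_instB.2 ⟨e, e.2, 0, rfl⟩, mem_instB.2 ⟨e, e.2, 1, rfl⟩⟩)
    (by
      have hvw : ∀ v e x, x ∈ (p v).support → x ∈ (q e).support → False := by
        intro v e x hx hy
        obtain ⟨i, rfl, hi⟩ := hpsupp v x hx
        rcases hqsupp e _ hy with ⟨k, hk⟩ | ⟨u, j, hu, hj⟩
        · simp at hk
        · simp only [Sum.inl.injEq, Prod.mk.injEq] at hu
          obtain ⟨rfl, rfl⟩ := hu
          tauto
      rintro (v | e) (w | e') x hx hy
      · obtain ⟨i, rfl, -⟩ := hpsupp v x hx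
        obtain ⟨j, hj, -⟩ := hpsupp w _ hy
        simp only [Sum.inl.injEq, Prod.mk.injEq] at hj
        rw [hj.1]
      · exact (hvw v e' x hx hy).elim
      · exact (hvw w e x hy hx).elim
      · congr 1
        rcases hqsupp e x hx with ⟨k, rfl⟩ | ⟨u, i, rfl, -, -, -, he, hi⟩
        · rcases hqsupp e' _ hy with ⟨k', hk⟩ | ⟨u', i', hu, -⟩
          · simp only [Sum.inr.injEq, Prod.mk.injEq] at hk
            exact Subtype.ext hk.1
          · simp at hu
        · rcases hqsupp e' _ hy with ⟨k', hk⟩ | ⟨u', i', hu, -, -, -, he', hi'⟩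
          · simp at hk
          · simp only [Sum.inl.injEq, Prod.mk.injEq] at hu
            obtain ⟨rfl, rfl⟩ := hu
            have h1 := hσmem u e he
            have h2 := hσmem u e' he'
            exact Subtype.ext (hσinj u he he' (by omega)))
    (by
      intro z hz
      rcases Finset.mem_union.1 hz with hz | hz
      · obtain ⟨v, hv⟩ := mem_instA.1 hz
        exact ⟨.inl v, hv⟩
      · obtain ⟨e, he, k, rfl⟩ := mem_instB.1 hz
        refine ⟨.inr ⟨e, he⟩, ?_⟩
        fin_cases k <;> simp)
    (by
      rintro (v | e)
      · exact hplen v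
      · exact hqlen e)
  refine ⟨E', hE', ?_⟩
  have hsum : (∑ v, if v ∈ S then 11 else 12) + S.card = 12 * Fintype.card V := by
    have hcard : S.card = ∑ v, if v ∈ S then 1 else 0 := by simp
    rw [hcard, ← Finset.sum_add_distrib,
      Finset.sum_congr rfl (g := fun _ => 12) fun v _ => by split_ifs <;> rfl]
    simp [mul_comm]
  rw [Fintype.sum_sum_type] at hlen
  simp only [Sum.elim_inl, Sum.elim_inr, Finset.sum_const, Finset.card_univ, smul_eq_mul] at hlen
  rw [← SimpleGraph.edgeFinset_card] at hlen
  omega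

end Bounds

/-!
STATEMENT 7.  A solution to Disjoint `A`,`B`-paths on the instance `I` exists, and
the minimum length satisfies `ℓ_{A,B} = 12|V| + 3|E| − α(G)`.
-/
theorem stmt7 {V : Type} [Fintype V] [DecidableEq V]
    (G : SimpleGraph V) [DecidableRel G.Adj]
    (hcubic : ∀ v : V, G.degree v = 3)
    (σ : V → Sym2 V → ℕ) (fs sn : Sym2 V → V)
    (hfssn : ∀ e ∈ G.edgeSet, e = s(fs e, sn e))
    (hσmem : ∀ v : V, ∀ e ∈ G.incidenceSet v, σ v e = 2 ∨ σ v e = 4 ∨ σ v e = 6)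
    (hσinj : ∀ v : V, Set.InjOn (σ v) (G.incidenceSet v)) :
    (∃ E', IsSolution (instGraph G σ fs sn) (instA V) (instB G) E') ∧
    lAB (instGraph G σ fs sn) (instA V) (instB G) instLen =
      12 * Fintype.card V + 3 * G.edgeFinset.card - indepNum G := by
  obtain ⟨S, hS, hcard⟩ := exists_card_eq_indepNum G
  obtain ⟨E', hE', hlen⟩ := exists_isSolution_of_independent hfssn hσmem hσinj hS
  refine ⟨⟨E', hE'⟩, le_antisymm ?_ ?_⟩
  · have hle : lAB (instGraph G σ fs sn) (instA V) (instB G) instLen ≤ lengthOf instLen E' :=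
      Nat.sInf_le ⟨E', hE', rfl⟩
    omega
  · refine le_csInf ⟨_, E', hE', rfl⟩ ?_
    rintro n ⟨E'', hE'', rfl⟩
    have := le_lengthOf_of_isSolution hfssn hσmem hσinj hE''
    omega
end
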